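/- In the Marsh–Rietsch setup over ℝ with all parameters t_r > 0: the matrix gᵀ·ẇ admits a UDL factorization, and every top-aligned flag minor of the matrix v̇·[gᵀẇ]_L^+ is nonnegative. -/

import Mathlib

open Matrix Finset

namespace Paper

open scoped Classical

noncomputable section

variable {K : Type*} [Field K] {n m : ℕ}

/-- `N`: upper unitriangular matrices. -/
def IsN (g : Matrix (Fin n) (Fin n) K) : Prop :=
  (∀ i, g i i = 1) ∧ ∀ i j : Fin n, j < i → g i j = 0

/-- `N₋`: lower unitriangular matrices. -/
def IsNm (g : Matrix (Fin n) (Fin n) K) : Prop :=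
  (∀ i, g i i = 1) ∧ ∀ i j : Fin n, i < j → g i j = 0

/-- `B`: upper triangular matrices of determinant 1. -/
def IsB (g : Matrix (Fin n) (Fin n) K) : Prop :=
  g.det = 1 ∧ ∀ i j : Fin n, j < i → g i j = 0

/-- `B₋`: lower triangular matrices of determinant 1. -/
def IsBm (g : Matrix (Fin n) (Fin n) K) : Prop :=
  g.det = 1 ∧ ∀ i j : Fin n, i < j → g i j = 0

/-- `H`: diagonal matrices of determinant 1. -/
def IsH (g : Matrix (Fin n) (Fin n) K) : Prop :=
  g.det = 1 ∧ ∀ i j : Fin n, i ≠ j → g i j = 0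

/-- UDL factorization: `g = yp * y0 * ym` with `yp ∈ N`, `y0 ∈ H`, `ym ∈ N₋`. -/
def UDL (g yp y0 ym : Matrix (Fin n) (Fin n) K) : Prop :=
  IsN yp ∧ IsH y0 ∧ IsNm ym ∧ g = yp * y0 * ym

/-- LDU factorization: `g = zm * z0 * zp` with `zm ∈ N₋`, `z0 ∈ H`, `zp ∈ N`. -/
def LDU (g zm z0 zp : Matrix (Fin n) (Fin n) K) : Prop :=
  IsNm zm ∧ IsH z0 ∧ IsN zp ∧ g = zm * z0 * zp

/-- The signed permutation matrix `v̇`. -/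
def pdot (v : Equiv.Perm (Fin n)) : Matrix (Fin n) (Fin n) K :=
  Matrix.of fun a b : Fin n =>
    if a = v b then
      (-1 : K) ^ (univ.filter fun k : Fin n => b < k ∧ v k < v b).card
    else 0

/-- Membership in the double coset `B₋ w B₋`. -/
def InBmWBm (w : Equiv.Perm (Fin n)) (g : Matrix (Fin n) (Fin n) K) : Prop :=
  ∃ b₁ b₂ : Matrix (Fin n) (Fin n) K, IsBm b₁ ∧ IsBm b₂ ∧ g = b₁ * pdot w * b₂

/-- `Δ^I_J(g)`: the minor with row set `I` and column set `J` (junk value 0 if sizes differ). -/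
def minor (g : Matrix (Fin n) (Fin n) K) (I J : Finset (Fin n)) : K :=
  if h : I.card = J.card then
    Matrix.det (Matrix.of fun a b : Fin I.card =>
      g (I.orderEmbOfFin rfl a) (J.orderEmbOfFin h.symm b))
  else 0

/-- All right-aligned flag minors of `g` are nonnegative. -/
def RightFlagNonneg (g : Matrix (Fin n) (Fin n) ℝ) : Prop :=
  ∀ I : Finset (Fin n),
    0 ≤ minor g I (univ.filter fun j : Fin n => n - I.card ≤ (j : ℕ))

/-- All top-aligned flag minors of `g` are nonnegative. -/
def TopFlagNonneg (g : Matrix (Fin n) (Fin n) ℝ) : Prop :=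
  ∀ J : Finset (Fin n),
    0 ≤ minor g (univ.filter fun i : Fin n => (i : ℕ) < J.card) J

/-- `x_i(t)` (with 1-based `i`): `Id + t·E_{i,i+1}`. -/
def xmat (i : ℕ) (t : K) : Matrix (Fin n) (Fin n) K :=
  Matrix.of fun a b : Fin n =>
    if a = b then 1 else if (a : ℕ) + 1 = i ∧ (b : ℕ) = i then t else 0

/-- `y_i(t)` (with 1-based `i`): `Id + t·E_{i+1,i}`. -/
def ymat (i : ℕ) (t : K) : Matrix (Fin n) (Fin n) K :=
  Matrix.of fun a b : Fin n =>
    if a = b then 1 else if (a : ℕ) = i ∧ (b : ℕ) + 1 = i then t else 0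

/-- `ṡ_i` (with 1-based `i`). -/
def sdot (i : ℕ) : Matrix (Fin n) (Fin n) K :=
  Matrix.of fun a b : Fin n =>
    if (a : ℕ) + 1 = i ∧ (b : ℕ) = i then 1
    else if (a : ℕ) = i ∧ (b : ℕ) + 1 = i then -1
    else if a = b ∧ (a : ℕ) + 1 ≠ i ∧ (a : ℕ) ≠ i then 1
    else 0

/-- The adjacent transposition `s_i` (with 1-based `i`); identity if out of range. -/
def sperm (n : ℕ) (i : ℕ) : Equiv.Perm (Fin n) :=
  if h : i < n then
    Equiv.swap ⟨i - 1, Nat.lt_of_le_of_lt (Nat.sub_le i 1) h⟩ ⟨i, h⟩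
  else 1

/-- `ℓ(w)`: the number of inversions of `w`. -/
def len (w : Equiv.Perm (Fin n)) : ℕ :=
  (univ.filter fun p : Fin n × Fin n => p.1 < p.2 ∧ w p.2 < w p.1).card

/-- `vseq ii v k = v_{(m-k)}`: the rightmost (positive distinguished) subexpression recursion. -/
def vseq (ii : Fin m → ℕ) (v : Equiv.Perm (Fin n)) : ℕ → Equiv.Perm (Fin n)
  | 0 => v
  | k + 1 =>
    if h : m - k - 1 < m then
      if len (vseq ii v k * sperm n (ii ⟨m - k - 1, h⟩)) < len (vseq ii v k) then
        vseq ii v k * sperm n (ii ⟨m - k - 1, h⟩)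
      else vseq ii v k
    else vseq ii v k

/-- `r ∈ J°` (0-based `r`, corresponding to the 1-based index `r+1`). -/
def inJ (ii : Fin m → ℕ) (v : Equiv.Perm (Fin n)) (r : Fin m) : Prop :=
  vseq ii v (m - (r : ℕ)) = vseq ii v (m - (r : ℕ) - 1)

/-- The list `[s_{i_1}, …, s_{i_m}]` of adjacent transpositions. -/
def sPermList (n : ℕ) (ii : Fin m → ℕ) : List (Equiv.Perm (Fin n)) :=
  List.ofFn fun r => sperm n (ii r)

/-- The list `[s^v_{i_1}, …, s^v_{i_m}]`. -/
def svPermList (ii : Fin m → ℕ) (v : Equiv.Perm (Fin n)) : List (Equiv.Perm (Fin n)) :=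
  List.ofFn fun r => if inJ ii v r then 1 else sperm n (ii r)

/-- The factors `g_1, …, g_m` of the Marsh–Rietsch element. -/
def mrgList (ii : Fin m → ℕ) (v : Equiv.Perm (Fin n)) (t : Fin m → K) :
    List (Matrix (Fin n) (Fin n) K) :=
  List.ofFn fun r => if inJ ii v r then xmat (ii r) (t r) else sdot (ii r)

/-- The Marsh–Rietsch element `g = g_1 ⋯ g_m`. -/
def mrg (ii : Fin m → ℕ) (v : Equiv.Perm (Fin n)) (t : Fin m → K) :
    Matrix (Fin n) (Fin n) K :=
  (mrgList ii v t).prod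

/-- The list `[ṡ_{i_1}, …, ṡ_{i_m}]`. -/
def sdotList (n : ℕ) (ii : Fin m → ℕ) : List (Matrix (Fin n) (Fin n) K) :=
  List.ofFn fun r => sdot (ii r)

/-- `ẇ = ṡ_{i_1} ⋯ ṡ_{i_m}`. -/
def wMR (n : ℕ) (ii : Fin m → ℕ) : Matrix (Fin n) (Fin n) K :=
  (sdotList n ii).prod

section plucker

/-- truncated column -/
def tcol (A : Matrix (Fin n) (Fin n) ℝ) {l : ℕ} (h : l ≤ n) (j : Fin n) : Fin l → ℝ :=
  fun a => A (Fin.castLE h a) j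

def vdet {l : ℕ} (c : Fin l → (Fin l → ℝ)) : ℝ := Matrix.det (Matrix.of c)

def DD (A : Matrix (Fin n) (Fin n) ℝ) {l : ℕ} (h : l ≤ n) (c : Fin l → Fin n) : ℝ :=
  vdet fun b => tcol A h (c b)

lemma card_le_n (S : Finset (Fin n)) : S.card ≤ n := by
  simpa using S.card_le_univ

def pl (A : Matrix (Fin n) (Fin n) ℝ) (S : Finset (Fin n)) : ℝ :=
  DD A (card_le_n S) (S.orderEmbOfFin rfl)

lemma pl_eq (A : Matrix (Fin n) (Fin n) ℝ) (S : Finset (Fin n)) {l : ℕ} (hl : S.card = l)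
    (h : l ≤ n) : pl A S = DD A h (S.orderEmbOfFin hl) := by
  subst hl; rfl

def VV {l : ℕ} (c : Fin l → Fin n) : ℝ :=
  (Matrix.vandermonde fun a => ((c a : ℕ) : ℝ)).det

lemma VV_pos {l : ℕ} {c : Fin l → Fin n} (hc : StrictMono c) : 0 < VV c := by
  unfold VV
  rw [Matrix.det_vandermonde]
  refine Finset.prod_pos fun i _ => Finset.prod_pos fun j hj => ?_
  have : c i < c j := hc (Finset.mem_Ioi.1 hj)
  have : ((c i : ℕ) : ℝ) < ((c j : ℕ) : ℝ) := by exact_mod_cast this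
  linarith

lemma VV_cons {l : ℕ} (x : Fin n) (c : Fin l → Fin n) :
    VV (Fin.cons x c : Fin (l+1) → Fin n) = (∏ j, (((c j : ℕ) : ℝ) - ((x : ℕ) : ℝ))) * VV c := by
  unfold VV
  rw [Matrix.det_vandermonde, Matrix.det_vandermonde, Fin.prod_univ_succ]
  simp [Fin.prod_Ioi_succ]

lemma VV_perm {l : ℕ} (c : Fin l → Fin n) (σ : Equiv.Perm (Fin l)) :
    VV (c ∘ σ) = (Equiv.Perm.sign σ : ℤ) * VV c := by
  unfold VV
  rw [← Matrix.det_permute σ]; rfl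

lemma DD_perm (A : Matrix (Fin n) (Fin n) ℝ) {l : ℕ} (h : l ≤ n) (c : Fin l → Fin n)
    (σ : Equiv.Perm (Fin l)) :
    DD A h (c ∘ σ) = (Equiv.Perm.sign σ : ℤ) * DD A h c := by
  unfold DD vdet
  rw [← Matrix.det_permute σ]; rfl

lemma exists_perm {l : ℕ} (c : Fin l → Fin n) (hc : Function.Injective c) :
    ∃ (hS : (Finset.univ.image c).card = l) (σ : Equiv.Perm (Fin l)),
      c = (Finset.univ.image c).orderEmbOfFin hS ∘ σ := by
  have hS : (Finset.univ.image c).card = l := by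
    rw [Finset.card_image_of_injective _ hc]; simp
  refine ⟨hS, ?_⟩
  let f : Fin l → Fin l := fun b =>
    ((Finset.univ.image c).orderIsoOfFin hS).symm ⟨c b, by simp⟩
  have hf : Function.Injective f := by
    intro a b hab
    have := ((Finset.univ.image c).orderIsoOfFin hS).symm.injective hab
    exact hc (by simpa using this)
  refine ⟨Equiv.ofBijective f (Finite.injective_iff_bijective.1 hf), ?_⟩
  ext b
  simp only [Function.comp_apply, Equiv.ofBijective_apply, f]
  rw [← Finset.coe_orderIsoOfFin_apply]
  simp

lemma sgn_lemma (A : Matrix (Fin n) (Fin n) ℝ) {l : ℕ} (h : l ≤ n) (c : Fin l → Fin n)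
    (hc : Function.Injective c) (s : ℝ) (hs : s * s = 1) (hV : 0 < s * VV c) :
    pl A (Finset.univ.image c) = s * DD A h c := by
  obtain ⟨hS, σ, hσ⟩ := exists_perm c hc
  set e := (Finset.univ.image c).orderEmbOfFin hS with he
  have h1 : VV c = (Equiv.Perm.sign σ : ℤ) * VV (e : Fin l → Fin n) := by
    conv_lhs => rw [hσ]
    exact VV_perm _ _
  have h2 : DD A h c = (Equiv.Perm.sign σ : ℤ) * DD A h (e : Fin l → Fin n) := by
    conv_lhs => rw [hσ]
    exact DD_perm _ _ _ _
  rw [pl_eq A _ hS h, ← he, h2]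
  have h3 : 0 < VV (e : Fin l → Fin n) := VV_pos e.strictMono
  rw [h1] at hV
  rcases Int.units_eq_one_or (Equiv.Perm.sign σ) with h4 | h4 <;> rw [h4] at hV ⊢ <;>
    rcases mul_self_eq_one_iff.1 hs with h5 | h5 <;> subst h5 <;> simp at hV ⊢ <;> linarith

/-- sign of inserting x into R -/
def ep (R : Finset (Fin n)) (x : Fin n) : ℝ := ∏ r ∈ R, if x < r then 1 else -1

lemma ep_sq (R : Finset (Fin n)) (x : Fin n) : ep R x * ep R x = 1 := by
  unfold ep
  rw [← Finset.prod_mul_distrib]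
  refine Finset.prod_eq_one fun r _ => ?_
  split_ifs <;> norm_num

lemma ep_pos (R : Finset (Fin n)) (x : Fin n) (hx : x ∉ R) :
    0 < ep R x * ∏ j, (((R.orderEmbOfFin rfl j : ℕ) : ℝ) - ((x : ℕ) : ℝ)) := by
  have : ∏ j, (((R.orderEmbOfFin rfl j : ℕ) : ℝ) - ((x : ℕ) : ℝ)) =
      ∏ r ∈ R, (((r : ℕ) : ℝ) - ((x : ℕ) : ℝ)) := by
    conv_rhs => rw [← Finset.map_orderEmbOfFin_univ R rfl]
    rw [Finset.prod_map]; rfl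
  rw [this, ep, ← Finset.prod_mul_distrib]
  refine Finset.prod_pos fun r hr => ?_
  split_ifs with h
  · have : ((x : ℕ) : ℝ) < ((r : ℕ) : ℝ) := by exact_mod_cast h
    linarith
  · have h2 : r < x := lt_of_le_of_ne (not_lt.1 h) (fun h => hx (h ▸ hr))
    have : ((r : ℕ) : ℝ) < ((x : ℕ) : ℝ) := by exact_mod_cast h2
    linarith

lemma ep_eq (R : Finset (Fin n)) (i i' : Fin n) (hlt : i < i')
    (h : ∀ r ∈ R, r < i ∨ i' < r) : ep R i = ep R i' := by
  unfold ep
  refine Finset.prod_congr rfl fun r hr => ?_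
  rcases h r hr with h | h
  · rw [if_neg (not_lt.2 h.le), if_neg (not_lt.2 (h.le.trans hlt.le))]
  · rw [if_pos h, if_pos (hlt.trans h)]

lemma image_cons {l : ℕ} (x : Fin n) (c : Fin l → Fin n) :
    Finset.univ.image (Fin.cons x c : Fin (l+1) → Fin n) = insert x (Finset.univ.image c) := by
  ext y
  simp only [Finset.mem_image, Finset.mem_univ, true_and, Finset.mem_insert]
  constructor
  · rintro ⟨a, rfl⟩
    refine Fin.cases ?_ (fun a => ?_) a <;> simp
  · rintro (rfl | ⟨a, rfl⟩)
    · exact ⟨0, rfl⟩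
    · exact ⟨a.succ, rfl⟩

lemma image_emb (R : Finset (Fin n)) : Finset.univ.image (R.orderEmbOfFin rfl) = R :=
  Finset.image_orderEmbOfFin_univ R rfl

lemma mem_range_emb (R : Finset (Fin n)) (x : Fin n) :
    x ∈ Set.range (R.orderEmbOfFin rfl) ↔ x ∈ R := by
  rw [Finset.range_orderEmbOfFin]; simp

lemma card1 {R : Finset (Fin n)} {x : Fin n} (hx : x ∉ R) : R.card + 1 ≤ n := by
  have := card_le_n (insert x R)
  rwa [Finset.card_insert_of_notMem hx] at this

lemma pl_insert (A : Matrix (Fin n) (Fin n) ℝ) (R : Finset (Fin n)) (x : Fin n) (hx : x ∉ R) 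
    (h : R.card + 1 ≤ n) :
    pl A (insert x R) = ep R x * DD A h (Fin.cons x (R.orderEmbOfFin rfl)) := by
  have := sgn_lemma A h (Fin.cons x (R.orderEmbOfFin rfl)) ?_ (ep R x) (ep_sq R x) ?_
  · rwa [image_cons, image_emb] at this
  · rw [Fin.cons_injective_iff, mem_range_emb]
    exact ⟨hx, (R.orderEmbOfFin rfl).injective⟩
  · rw [VV_cons, ← mul_assoc]
    exact mul_pos (ep_pos R x hx) (VV_pos (R.orderEmbOfFin rfl).strictMono)

lemma pl_insert2 (A : Matrix (Fin n) (Fin n) ℝ) (R : Finset (Fin n)) (x y : Fin n) (hx : x ∉ R)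
    (hy : y ∉ R) (hxy : x < y) (h : R.card + 1 + 1 ≤ n) :
    pl A (insert x (insert y R)) = ep R x * ep R y *
      DD A h (Fin.cons x (Fin.cons y (R.orderEmbOfFin rfl) : Fin (R.card + 1) → Fin n)) := by
  have := sgn_lemma A h (Fin.cons x (Fin.cons y (R.orderEmbOfFin rfl) : Fin (R.card + 1) → Fin n))
    ?_ (ep R x * ep R y) (by linear_combination (ep R y * ep R y) * ep_sq R x + ep_sq R y) ?_
  · rwa [image_cons, image_cons, image_emb] at this
  · rw [Fin.cons_injective_iff, Fin.cons_injective_iff, mem_range_emb]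
    refine ⟨?_, hy, (R.orderEmbOfFin rfl).injective⟩
    rintro ⟨a, ha⟩
    induction a using Fin.cases with
    | zero => simp at ha; exact hxy.ne' ha
    | succ a => 
      simp at ha; exact hx (ha ▸ Finset.orderEmbOfFin_mem _ _ _)
  · rw [VV_cons, VV_cons, Fin.prod_univ_succ]
    simp only [Fin.cons_zero, Fin.cons_succ]
    have h1 := ep_pos R x hx
    have h2 := ep_pos R y hy
    have h3 : 0 < VV (R.orderEmbOfFin rfl) := VV_pos (R.orderEmbOfFin rfl).strictMono
    have h4 : 0 < ((y : ℕ) : ℝ) - ((x : ℕ) : ℝ) := by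
      have : ((x : ℕ) : ℝ) < ((y : ℕ) : ℝ) := by exact_mod_cast hxy
      linarith
    have := mul_pos (mul_pos h4 h3) (mul_pos h1 h2)
    refine lt_of_lt_of_eq this ?_
    ring

lemma vdet_swap2 {l : ℕ} (x y : Fin (l+2) → ℝ) (r : Fin l → (Fin (l+2) → ℝ)) :
    vdet (Fin.cons x (Fin.cons y r : Fin (l+1) → _)) =
      - vdet (Fin.cons y (Fin.cons x r : Fin (l+1) → _)) := by
  unfold vdet
  rw [show (Matrix.of (Fin.cons x (Fin.cons y r : Fin (l+1) → _)) : Matrix (Fin (l+2)) (Fin (l+2)) ℝ)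
    = (Matrix.of (Fin.cons y (Fin.cons x r : Fin (l+1) → _)) : Matrix (Fin (l+2)) (Fin (l+2)) ℝ).submatrix
      (Equiv.swap 0 (Fin.succ 0)) id from ?_, Matrix.det_permute]
  · rw [Equiv.Perm.sign_swap (Fin.succ_ne_zero _).symm]; simp
  · ext a b
    refine Fin.cases ?_ (fun a => Fin.cases ?_ (fun a => ?_) a) a
    · rw [Matrix.submatrix_apply, Equiv.swap_apply_left]; rfl
    · rw [Matrix.submatrix_apply, Equiv.swap_apply_right]; rfl
    · rw [Matrix.submatrix_apply, Equiv.swap_apply_of_ne_of_ne]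
      · simp [Fin.cons]
      · exact Fin.succ_ne_zero _
      · intro h
        have := Fin.succ_injective _ h
        exact Fin.succ_ne_zero _ this

lemma vdet_lin {l : ℕ} (r : Fin l → (Fin (l+1) → ℝ)) :
    ∃ φ : (Fin (l+1) → ℝ) →ₗ[ℝ] ℝ, ∀ x, φ x = vdet (Fin.cons x r : Fin (l+1) → _) := by
  refine ⟨(Matrix.detRowAlternating (R := ℝ) (n := Fin (l+1))).toMultilinearMap.toLinearMap
    (Fin.cons 0 r) 0, fun x => ?_⟩
  simp [vdet, Fin.update_cons_zero]
  rfl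

/-- Cramer's rule -/
lemma cramer_rule {l : ℕ} (c : Fin l → (Fin l → ℝ)) (x : Fin l → ℝ) :
    vdet c • x = ∑ j, vdet (Function.update c j x) • c j := by
  have h := Matrix.mulVec_cramer (Matrix.of c)ᵀ x
  rw [Matrix.det_transpose] at h
  unfold vdet
  rw [← h]
  ext a
  simp only [Matrix.mulVec, dotProduct, Matrix.cramer_transpose_apply, Finset.sum_apply, Pi.smul_apply,
    smul_eq_mul, Matrix.transpose_apply, Matrix.of_apply]
  refine Finset.sum_congr rfl fun j _ => ?_
  rw [mul_comm]; rfl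

lemma vdet_eq_zero {l : ℕ} (c : Fin l → (Fin l → ℝ)) (i j : Fin l) (hij : i ≠ j) (h : c i = c j) :
    vdet c = 0 := Matrix.det_zero_of_row_eq hij h

/-- three term relation -/
lemma three_term {l : ℕ} (a b x y : Fin (l+2) → ℝ) (r : Fin l → (Fin (l+2) → ℝ)) :
    vdet (Fin.cons a (Fin.cons b r : Fin (l+1) → _)) * vdet (Fin.cons x (Fin.cons y r : Fin (l+1) → _))
    = vdet (Fin.cons x (Fin.cons b r : Fin (l+1) → _)) * vdet (Fin.cons a (Fin.cons y r : Fin (l+1) → _))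
    + vdet (Fin.cons a (Fin.cons x r : Fin (l+1) → _)) * vdet (Fin.cons b (Fin.cons y r : Fin (l+1) → _)) := by
  obtain ⟨φ, hφ⟩ := vdet_lin (Fin.cons y r : Fin (l+1) → _)
  have h := congrArg φ (cramer_rule (Fin.cons a (Fin.cons b r : Fin (l+1) → _)) x)
  rw [map_smul, map_sum, Fin.sum_univ_succ, Fin.sum_univ_succ] at h
  simp only [map_smul φ, smul_eq_mul] at h
  simp only [hφ] at h
  rw [h]
  have : ∀ j : Fin l, vdet (Fin.cons (r j) (Fin.cons y r : Fin (l+1) → _)) = 0 := by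
    intro j
    exact vdet_eq_zero _ 0 j.succ.succ (Fin.succ_ne_zero _).symm rfl
  simp only [Fin.cons_zero, Fin.cons_succ, Fin.update_cons_zero, this, mul_zero,
    Finset.sum_const_zero, add_zero]
  congr 3
  rw [← Fin.cons_update, Fin.update_cons_zero]

lemma DD_cons2 (A : Matrix (Fin n) (Fin n) ℝ) {l : ℕ} (h : l + 1 + 1 ≤ n) (x y : Fin n) (c : Fin l → Fin n) :
    DD A h (Fin.cons x (Fin.cons y c : Fin (l+1) → Fin n)) =
      vdet (Fin.cons (tcol A h x) (Fin.cons (tcol A h y) (fun b => tcol A h (c b)) : Fin (l+1) → _)) := by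
  unfold DD
  congr 1
  ext a
  refine Fin.cases ?_ (fun a => Fin.cases ?_ (fun a => ?_) a) a <;> simp

lemma DD_cons1 (A : Matrix (Fin n) (Fin n) ℝ) {l : ℕ} (h : l + 1 ≤ n) (x : Fin n) (c : Fin l → Fin n) :
    DD A h (Fin.cons x c : Fin (l+1) → Fin n) =
      vdet (Fin.cons (tcol A h x) (fun b => tcol A h (c b)) : Fin (l+1) → _) := by
  unfold DD
  congr 1
  ext a
  refine Fin.cases ?_ (fun a => ?_) a <;> simp

lemma card2 {R : Finset (Fin n)} {x y : Fin n} (hx : x ∉ R) (hy : y ∉ R) (hxy : x ≠ y) : 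
    R.card + 1 + 1 ≤ n := by
  have := card_le_n (insert x (insert y R))
  rwa [Finset.card_insert_of_notMem (by simp [hxy, hx]), Finset.card_insert_of_notMem hy] at this

lemma P1 (A : Matrix (Fin n) (Fin n) ℝ) (R : Finset (Fin n)) {a b c d : Fin n} (ha : a ∉ R) (hb : b ∉ R)
    (hc : c ∉ R) (hd : d ∉ R) (hab : a < b) (hbc : b < c) (hcd : c < d) :
    pl A (insert a (insert b R)) * pl A (insert c (insert d R))
    + pl A (insert a (insert d R)) * pl A (insert b (insert c R))
    = pl A (insert a (insert c R)) * pl A (insert b (insert d R)) := by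
  have h := card2 ha hb hab.ne
  rw [pl_insert2 A R a b ha hb hab h, pl_insert2 A R c d hc hd hcd h,
    pl_insert2 A R a d ha hd (hab.trans (hbc.trans hcd)) h, pl_insert2 A R b c hb hc hbc h,
    pl_insert2 A R a c ha hc (hab.trans hbc) h, pl_insert2 A R b d hb hd (hbc.trans hcd) h]
  simp only [DD_cons2]
  have := three_term (tcol A h a) (tcol A h b) (tcol A h c) (tcol A h d)
    (fun t => tcol A h (R.orderEmbOfFin rfl t))
  rw [vdet_swap2 (tcol A h c) (tcol A h b)] at this
  linear_combination ep R a * ep R b * ep R c * ep R d * this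

/-- reduction of the last coordinate -/
lemma vdet_last {l : ℕ} (c : Fin l → (Fin (l+1) → ℝ)) :
    vdet (Fin.cons (Pi.single (Fin.last l) 1) c : Fin (l+1) → _) =
      (-1) ^ l * vdet (fun b => (fun a => c b a.castSucc)) := by
  unfold vdet
  rw [Matrix.det_succ_row _ 0, Finset.sum_eq_single (Fin.last l)]
  · simp
    congr 1
  · intro b _ hb
    simp [hb]
  · simp

lemma P2 (A : Matrix (Fin n) (Fin n) ℝ) (R : Finset (Fin n)) {a b c : Fin n} (ha : a ∉ R) (hb : b ∉ R)
    (hc : c ∉ R) (hab : a < b) (hbc : b < c) :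
    pl A (insert a R) * pl A (insert b (insert c R))
    + pl A (insert c R) * pl A (insert a (insert b R))
    = pl A (insert b R) * pl A (insert a (insert c R)) := by
  have h := card2 ha hb hab.ne
  have h' := card1 ha
  rw [pl_insert2 A R a b ha hb hab h, 
    pl_insert2 A R b c hb hc hbc h,
    pl_insert2 A R a c ha hc (hab.trans hbc) h, pl_insert A R a ha h', pl_insert A R b hb h',
    pl_insert A R c hc h']
  have key : ∀ x, vdet (Fin.cons (tcol A h x) (Fin.cons (Pi.single (Fin.last _) 1) (fun t => tcol A h (R.orderEmbOfFin rfl t)) : Fin (R.card+1) → _))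
     = - ((-1)^(R.card+1) * DD A h' (Fin.cons x (R.orderEmbOfFin rfl))) := by
    intro x
    rw [vdet_swap2, vdet_last, DD_cons1]
    congr 3
    ext a t
    refine Fin.cases ?_ (fun a => ?_) a <;> simp <;> rfl
  simp only [DD_cons2]
  have := three_term (tcol A h a) (tcol A h b) (tcol A h c) (Pi.single (Fin.last _) 1)
    (fun t => tcol A h (R.orderEmbOfFin rfl t))
  rw [vdet_swap2 (tcol A h c) (tcol A h b), key, key, key] at this
  have h2 : ((-1:ℝ)^(R.card+1)) * ((-1:ℝ)^(R.card+1)) = 1 := by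
    rw [← mul_pow]; norm_num
  generalize ((-1:ℝ)^(R.card+1)) = s at *
  linear_combination (-ep R a * ep R b * ep R c * s) * this + (ep R a * ep R b * ep R c * (
     vdet (Fin.cons (tcol A h a) (Fin.cons (tcol A h c) fun t => tcol A h (R.orderEmbOfFin rfl t) : Fin (R.card+1) → _)) * DD A h' (Fin.cons b (R.orderEmbOfFin rfl))
     - vdet (Fin.cons (tcol A h a) (Fin.cons (tcol A h b) fun t => tcol A h (R.orderEmbOfFin rfl t) : Fin (R.card+1) → _)) * DD A h' (Fin.cons c (R.orderEmbOfFin rfl))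
     - vdet (Fin.cons (tcol A h b) (Fin.cons (tcol A h c) fun t => tcol A h (R.orderEmbOfFin rfl t) : Fin (R.card+1) → _)) * DD A h' (Fin.cons a (R.orderEmbOfFin rfl)))) * h2

lemma DD_inj (A : Matrix (Fin n) (Fin n) ℝ) {l : ℕ} (h : l ≤ n) (c : Fin l → Fin n)
    (hD : DD A h c ≠ 0) : Function.Injective c := by
  intro a b hab
  by_contra hne
  exact hD (vdet_eq_zero _ a b hne (by simp [hab]))

lemma pl_ne_of_DD (A : Matrix (Fin n) (Fin n) ℝ) {l : ℕ} (h : l ≤ n) (c : Fin l → Fin n)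
    (hD : DD A h c ≠ 0) : pl A (Finset.univ.image c) ≠ 0 := by
  obtain ⟨hS, σ, hσ⟩ := exists_perm c (DD_inj A h c hD)
  rw [pl_eq A _ hS h]
  intro h0
  apply hD
  rw [hσ, DD_perm, h0, mul_zero]

lemma exch (A : Matrix (Fin n) (Fin n) ℝ) (S T : Finset (Fin n)) {l : ℕ} (hl : S.card = l) (h : l ≤ n)
    (hS : pl A S ≠ 0) (a : Fin n) 
    (hspan : tcol A h a ∉ Submodule.span ℝ (tcol A h '' (T : Set (Fin n)))) :
    ∃ b ∈ S, b ∉ T ∧ pl A (insert a (S.erase b)) ≠ 0 := by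
  by_contra hcon
  push Not at hcon
  apply hspan
  rw [pl_eq A S hl h] at hS
  set e := S.orderEmbOfFin hl with he
  have hc := cramer_rule (fun b => tcol A h (e b)) (tcol A h a)
  have hS' : vdet (fun b => tcol A h (e b)) ≠ 0 := hS
  have : tcol A h a = (vdet (fun b => tcol A h (e b)))⁻¹ •
      ∑ j, vdet (Function.update (fun b => tcol A h (e b)) j (tcol A h a)) • tcol A h (e j) := by
    rw [← hc, smul_smul, inv_mul_cancel₀ hS', one_smul]
  rw [this]
  refine Submodule.smul_mem _ _ (Submodule.sum_mem _ fun j _ => ?_)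
  by_cases hj : e j ∈ T
  · exact Submodule.smul_mem _ _ (Submodule.subset_span ⟨e j, hj, rfl⟩)
  · have h1 := hcon (e j) (Finset.orderEmbOfFin_mem _ _ _) hj
    have h2 : vdet (Function.update (fun b => tcol A h (e b)) j (tcol A h a)) = 0 := by
      by_contra hne
      have h3 : DD A h (Function.update e j a) ≠ 0 := by
        unfold DD
        convert hne using 2
        ext b t
        by_cases hb : b = j
        · subst hb; simp
        · simp [hb]
      have h4 := pl_ne_of_DD A h _ h3
      apply h4
      rw [← h1]
      congr 1
      ext y
      simp only [Finset.mem_image, Finset.mem_univ, true_and, Finset.mem_insert, Finset.mem_erase]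
      constructor
      · rintro ⟨b, rfl⟩
        by_cases hb : b = j
        · subst hb; simp
        · right
          simp [hb]
          exact Finset.orderEmbOfFin_mem _ _ _
      · rintro (rfl | ⟨h5, h6⟩)
        · exact ⟨j, by simp⟩
        · rw [← Finset.mem_coe, ← Finset.range_orderEmbOfFin S hl] at h6
          obtain ⟨b, rfl⟩ := h6
          refine ⟨b, ?_⟩
          rw [Function.update_of_ne]
          rintro rfl
          exact h5 rfl
    rw [h2, zero_smul]
    exact Submodule.zero_mem _

lemma ext_aux (A : Matrix (Fin n) (Fin n) ℝ) (T : Finset (Fin n)) (h : T.card + 1 ≤ n) (U : Set (Fin n))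
    (x : Fin (T.card + 1) → ℝ) (hx : x ∈ Submodule.span ℝ (tcol A h '' U))
    (hD : vdet (Fin.cons x (fun b => tcol A h (T.orderEmbOfFin rfl b)) : Fin (T.card + 1) → _) ≠ 0) :
    ∃ u ∈ U, u ∉ T ∧ pl A (insert u T) ≠ 0 := by
  by_contra hcon
  push Not at hcon
  obtain ⟨φ, hφ⟩ := vdet_lin (fun b => tcol A h (T.orderEmbOfFin rfl b))
  apply hD
  rw [← hφ]
  have : Submodule.span ℝ (tcol A h '' U) ≤ LinearMap.ker φ := by
    rw [Submodule.span_le]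
    rintro _ ⟨u, hu, rfl⟩
    rw [SetLike.mem_coe, LinearMap.mem_ker, hφ, ← DD_cons1]
    by_contra hne
    have h1 := DD_inj A h _ hne
    rw [Fin.cons_injective_iff, mem_range_emb] at h1
    have h2 := pl_ne_of_DD A h _ hne
    rw [image_cons, image_emb] at h2
    exact h2 (hcon u hu h1.1)
  exact this hx

lemma ext_span (A : Matrix (Fin n) (Fin n) ℝ) (T : Finset (Fin n)) (h : T.card + 1 ≤ n) (U : Set (Fin n))
    (x : Fin n) (hxT : x ∉ T) (hx : tcol A h x ∈ Submodule.span ℝ (tcol A h '' U))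
    (hp : pl A (insert x T) ≠ 0) :
    ∃ u ∈ U, u ∉ T ∧ pl A (insert u T) ≠ 0 := by
  refine ext_aux A T h U _ hx ?_
  rw [pl_insert A T x hxT h, DD_cons1] at hp
  exact right_ne_zero_of_mul hp

lemma ext_one (A : Matrix (Fin n) (Fin n) ℝ) (hA : A.det ≠ 0) (T : Finset (Fin n)) (h : T.card + 1 ≤ n)
    (hp : pl A T ≠ 0) :
    ∃ u, u ∉ T ∧ pl A (insert u T) ≠ 0 := by
  have : ∃ u ∈ (Set.univ : Set (Fin n)), u ∉ T ∧ pl A (insert u T) ≠ 0 := by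
    refine ext_aux A T h Set.univ (Pi.single (Fin.last _) 1) ?_ ?_
    · have : (Pi.single (Fin.last T.card) 1 : Fin (T.card + 1) → ℝ) =
        ∑ j, A⁻¹ j (Fin.castLE h (Fin.last _)) • tcol A h j := by
        ext a
        have h1 : (A * A⁻¹) = 1 := Matrix.mul_nonsing_inv _ (isUnit_iff_ne_zero.2 hA)
        have h2 := congrFun (congrFun h1 (Fin.castLE h a)) (Fin.castLE h (Fin.last _))
        rw [Matrix.mul_apply] at h2
        simp only [Finset.sum_apply, Pi.smul_apply, smul_eq_mul, tcol]
        simp only [mul_comm (A⁻¹ _ _)]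
        rw [h2, Matrix.one_apply, Pi.single_apply]
        simp
      rw [this]
      exact Submodule.sum_mem _ fun j _ => Submodule.smul_mem _ _ (Submodule.subset_span ⟨j, trivial, rfl⟩)
    · rw [vdet_last]
      exact mul_ne_zero (pow_ne_zero _ (by norm_num)) hp
  obtain ⟨u, _, hu⟩ := this
  exact ⟨u, hu⟩

lemma del_one (A : Matrix (Fin n) (Fin n) ℝ) (M : Finset (Fin n)) (l : ℕ) (hl : M.card = l + 1)
    (hp : pl A M ≠ 0) : ∃ c ∈ M, pl A (M.erase c) ≠ 0 := by
  have h : l + 1 ≤ n := hl ▸ card_le_n M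
  have h' : l ≤ n := by omega
  rw [pl_eq A M hl h] at hp
  unfold DD vdet at hp
  rw [Matrix.det_succ_column _ (Fin.last l)] at hp
  obtain ⟨j, _, hj⟩ := Finset.exists_ne_zero_of_sum_ne_zero hp
  have h1 := right_ne_zero_of_mul hj
  refine ⟨M.orderEmbOfFin hl j, Finset.orderEmbOfFin_mem _ _ _, ?_⟩
  have h2 : DD A h' (fun b => M.orderEmbOfFin hl (j.succAbove b)) ≠ 0 := by
    unfold DD vdet
    convert h1 using 2
    ext a b
    simp [tcol]
  have h3 := pl_ne_of_DD A h' _ h2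
  convert h3 using 2
  ext y
  simp only [Finset.mem_erase, Finset.mem_image, Finset.mem_univ, true_and]
  constructor
  · rintro ⟨h5, h6⟩
    rw [← Finset.mem_coe, ← Finset.range_orderEmbOfFin M hl] at h6
    obtain ⟨b, rfl⟩ := h6
    have hb : b ≠ j := fun hh => h5 (by rw [hh])
    obtain ⟨z, hz⟩ := Fin.exists_succAbove_eq hb
    exact ⟨z, by rw [hz]⟩
  · rintro ⟨b, rfl⟩
    refine ⟨fun hh => ?_, Finset.orderEmbOfFin_mem _ _ _⟩
    exact Fin.succAbove_ne _ _ ((M.orderEmbOfFin hl).injective hh)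

/-- data for the key claim -/
structure KeyData (A : Matrix (Fin n) (Fin n) ℝ) (i i' : Fin n) (k k' : ℕ) (α β : ℝ) : Prop where
  det : A.det ≠ 0
  pos : ∀ S, 0 ≤ pl A S
  lt : i < i'
  gap : ∀ x, x ≠ i → x ≠ i' → x < i ∨ i' < x
  kk : k < k'
  kn : k' < n
  alpha : 0 < α
  F1 : ∀ l (h : l ≤ n), k < l → tcol A h i ∉ Submodule.span ℝ (tcol A h '' {a | a < i})
  F2 : ∀ l (h : l ≤ n), l ≤ k' →
    α • tcol A h i' - β • tcol A h i ∈ Submodule.span ℝ (tcol A h '' {a | a < i})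

section key
variable {A : Matrix (Fin n) (Fin n) ℝ} {i i' : Fin n} {k k' : ℕ} {α β : ℝ}

lemma KeyData.ppos (H : KeyData A i i' k k' α β) {S : Finset (Fin n)} (h : pl A S ≠ 0) : 0 < pl A S :=
  lt_of_le_of_ne (H.pos S) h.symm

lemma div_aux {x y z w α β : ℝ} (hy : 0 < y) (h1 : α * y ≤ β * w)
    (h2 : x * w ≤ y * z) (hα : 0 < α) (hw : 0 ≤ w) (hz : 0 ≤ z) : α * x ≤ β * z := by
  -- ratio x/z ≤ y/w ≤ β/α
  have hβw : 0 < β * w := lt_of_lt_of_le (mul_pos hα hy) h1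
  have hw' : 0 < w := lt_of_le_of_ne hw (by rintro rfl; simp at hβw)
  have h3 : α * x * w ≤ β * z * w := by
    calc α * x * w = α * (x * w) := by ring
      _ ≤ α * (y * z) := mul_le_mul_of_nonneg_left h2 hα.le
      _ = (α * y) * z := by ring
      _ ≤ (β * w) * z := mul_le_mul_of_nonneg_right h1 hz
      _ = β * z * w := by ring
  exact le_of_mul_le_mul_right h3 hw'

lemma KeyData.base (H : KeyData A i i' k k' α β) : ∀ (q : ℕ) (S : Finset (Fin n)), i ∉ S → i' ∉ S →
    S.card = k → (S.filter (fun x => i' < x)).card = q → pl A (insert i' S) ≠ 0 → 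
    α * pl A (insert i' S) ≤ β * pl A (insert i S) := by
  intro q
  induction q using Nat.strong_induction_on with
  | _ q ih =>
  intro S hiS hiS' hk hq h0
  have hlev : k + 1 ≤ n := by have := H.kk; have := H.kn; omega
  have hgap : ∀ r ∈ S, r < i ∨ i' < r := fun r hr =>
    H.gap r (fun h => hiS (h ▸ hr)) (fun h => hiS' (h ▸ hr))
  set S1 := S.filter (fun x => x < i) with hS1
  have hlev' : S.card + 1 ≤ n := by omega
  by_cases hsp : ∀ a, a < i → tcol A hlev' a ∈ Submodule.span ℝ (tcol A hlev' '' (S1 : Set (Fin n)))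
  · -- equality
    rw [pl_insert A S i' hiS' hlev', pl_insert A S i hiS hlev', ep_eq S i i' H.lt hgap]
    obtain ⟨φ, hφ⟩ := vdet_lin (fun b => tcol A hlev' (S.orderEmbOfFin rfl b))
    rw [DD_cons1, DD_cons1, ← hφ, ← hφ]
    have h1 := H.F2 _ hlev' (by have := H.kk; omega)
    have h2 : Submodule.span ℝ (tcol A hlev' '' {a | a < i}) ≤ LinearMap.ker φ := by
      refine le_trans (b := Submodule.span ℝ (tcol A hlev' '' (S1 : Set (Fin n)))) ?_ ?_
      · rw [Submodule.span_le]
        rintro _ ⟨a, ha, rfl⟩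
        exact hsp a ha
      · rw [Submodule.span_le]
        rintro _ ⟨a, ha, rfl⟩
        rw [SetLike.mem_coe, LinearMap.mem_ker, hφ, ← DD_cons1]
        by_contra hne
        have h1 := DD_inj A hlev' _ hne
        rw [Fin.cons_injective_iff, mem_range_emb] at h1
        exact h1.1 (Finset.mem_of_mem_filter _ (Finset.mem_coe.1 ha))
    have h3 := h2 h1
    rw [LinearMap.mem_ker, map_sub, map_smul, map_smul, smul_eq_mul, smul_eq_mul] at h3
    apply le_of_eq
    linear_combination ep S i' * h3
  · push Not at hsp
    obtain ⟨a, hai, ha⟩ := hsp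
    have haS : a ∉ S := fun h => ha (Submodule.subset_span ⟨a, by simp [hS1, h, hai], rfl⟩)
    have hai' : a < i' := hai.trans H.lt
    have final : ∀ b ∈ S, i' < b → 
        (pl A (insert a (insert i' (S.erase b))) ≠ 0 ∨ pl A (insert a (insert i (S.erase b))) ≠ 0) → 
        α * pl A (insert i' S) ≤ β * pl A (insert i S) := by
      intro b hbS hb hne
      set R := S.erase b with hR
      have hSR : S = insert b R := (Finset.insert_erase hbS).symm
      have haR : a ∉ R := fun h => haS (Finset.mem_of_mem_erase h)
      have hiR : i ∉ R := fun h => hiS (Finset.mem_of_mem_erase h)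
      have hiR' : i' ∉ R := fun h => hiS' (Finset.mem_of_mem_erase h)
      have hbR : b ∉ R := by simp [hR]
      have h3 := P1 A R haR hiR hiR' hbR hai H.lt hb
      rw [← hSR] at h3
      have hpi' : 0 < pl A (insert i' S) := H.ppos h0
      have hn1 := H.pos (insert a S)
      have hn2 := H.pos (insert i (insert i' R))
      have hne' : pl A (insert a (insert i' R)) ≠ 0 := by
        rcases hne with h | h
        · exact h
        · intro h4
          rw [h4] at h3
          have := mul_pos (H.ppos h) hpi'
          have := mul_nonneg hn1 hn2
          linarith
      have hcard : (insert a R).card = k := by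
        rw [Finset.card_insert_of_notMem haR, ← hk, hSR, Finset.card_insert_of_notMem hbR]
      have hlt : ((insert a R).filter (fun x => i' < x)).card < q := by
        rw [← hq, hSR, Finset.filter_insert, Finset.filter_insert, if_neg (not_lt.2 hai'.le), if_pos hb,
          Finset.card_insert_of_notMem (by simp [hbR])]
        omega
      have hi := ih _ hlt (insert a R) (by simp [hiR, hai.ne']) (by simp [hiR', hai'.ne']) hcard rfl
        (by rwa [Finset.insert_comm])
      rw [Finset.insert_comm i', Finset.insert_comm i] at hi
      refine div_aux (H.ppos hne') hi ?_ H.alpha (H.pos _) (H.pos _)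
      have := mul_nonneg hn1 hn2
      linarith
    have hb_of : ∀ b ∈ S, b ∉ S1 → i' < b := by
      intro b hb hb1
      rcases hgap b hb with h | h
      · exact absurd (by simp [hS1, hb, h]) hb1
      · exact h
    obtain ⟨b, hbM, hbT, hb⟩ := exch A (insert i' S) S1 (Finset.card_insert_of_notMem hiS') hlev' h0 a ha
    rw [Finset.mem_insert] at hbM
    rcases hbM with rfl | hbS
    · rw [Finset.erase_insert hiS'] at hb
      have hF := H.F1 _ hlev' (by omega)
      obtain ⟨b', hbM', hbT', hb'⟩ := exch A (insert a S) (insert a S1) (Finset.card_insert_of_notMem haS) hlev' hb i (by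
        intro hin
        apply hF
        refine Submodule.span_mono ?_ hin
        apply Set.image_mono
        intro x hx
        simp [hS1] at hx
        rcases hx with rfl | hx
        · exact hai
        · exact hx.2)
      simp only [Finset.mem_insert, not_or] at hbM' hbT'
      have hbS' : b' ∈ S := hbM'.resolve_left hbT'.1
      refine final b' hbS' (hb_of b' hbS' hbT'.2) (Or.inr ?_)
      rwa [Finset.erase_insert_of_ne (Ne.symm hbT'.1), Finset.insert_comm] at hb'
    · have hbi := hb_of b hbS hbT
      refine final b hbS hbi (Or.inl ?_)
      rwa [Finset.erase_insert_of_ne (hbi.ne)] at hb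

/-- levels below the base -/
lemma KeyData.up (H : KeyData A i i' k k' α β) : ∀ (q : ℕ) (S : Finset (Fin n)), i ∉ S → i' ∉ S →
    S.card + q = k → pl A (insert i' S) ≠ 0 → 
    α * pl A (insert i' S) ≤ β * pl A (insert i S) := by
  intro q
  induction q with
  | zero =>
    intro S hiS hiS' hk h0
    exact H.base _ S hiS hiS' (by omega) rfl h0
  | succ q ih =>
  intro S hiS hiS' hk h0
  have hkk := H.kk
  have hkn := H.kn
  have hcM : (insert i' S).card = S.card + 1 := Finset.card_insert_of_notMem hiS'
  have hp := H.ppos h0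
  -- adding a < i
  have caseA : ∀ a, a < i → a ∉ S → pl A (insert a (insert i' S)) ≠ 0 →
      α * pl A (insert i' S) ≤ β * pl A (insert i S) := by
    intro a hai haS hne
    have hai' := hai.trans H.lt
    have hi := ih (insert a S) (by simp [hiS, hai.ne']) (by simp [hiS', hai'.ne'])
      (by rw [Finset.card_insert_of_notMem haS]; omega) (by rwa [Finset.insert_comm])
    rw [Finset.insert_comm i', Finset.insert_comm i] at hi
    refine div_aux (H.ppos hne) hi ?_ H.alpha (H.pos _) (H.pos _)
    have h3 := P2 A S haS hiS hiS' hai H.lt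
    have := mul_nonneg (H.pos (insert a S)) (H.pos (insert i (insert i' S)))
    linarith
  by_cases hA : ∃ a, a < i ∧ a ∉ S ∧ pl A (insert a (insert i' S)) ≠ 0
  · obtain ⟨a, h1, h2, h3⟩ := hA
    exact caseA a h1 h2 h3
  push Not at hA
  have hii : pl A (insert i (insert i' S)) = 0 := by
    by_contra hne
    have hcT : (insert i S).card = S.card + 1 := Finset.card_insert_of_notMem hiS
    have hlev : (insert i S).card + 1 ≤ n := by omega
    obtain ⟨u, hu, huT, hup⟩ := ext_span A (insert i S) hlev (insert i {a | a < i}) i'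
      (by simp [hiS', H.lt.ne']) (by
        have h1 := H.F2 _ hlev (by omega)
        have h2 : α • tcol A hlev i' ∈ Submodule.span ℝ (tcol A hlev '' (insert i {a | a < i})) := by
          have e : α • tcol A hlev i' = (α • tcol A hlev i' - β • tcol A hlev i) + β • tcol A hlev i := by simp
          rw [e]
          refine Submodule.add_mem _ (Submodule.span_mono (Set.image_mono (Set.subset_insert _ _)) h1) ?_
          exact Submodule.smul_mem _ _ (Submodule.subset_span ⟨i, by simp, rfl⟩)
        have := Submodule.smul_mem _ α⁻¹ h2
        rwa [smul_smul, inv_mul_cancel₀ H.alpha.ne', one_smul] at this)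
      (by rwa [Finset.insert_comm])
    simp only [Finset.mem_insert, not_or] at huT
    rcases hu with rfl | hu
    · exact huT.1 rfl
    · have hz := hA u hu huT.2
      have h3 := P2 A S huT.2 hiS hiS' hu H.lt
      rw [hz] at h3
      have h4 := mul_pos hp (H.ppos hup)
      have := mul_nonneg (H.pos (insert u S)) (H.pos (insert i (insert i' S)))
      linarith
  obtain ⟨c, hcM', hc⟩ := ext_one A H.det (insert i' S) (by omega) h0
  simp only [Finset.mem_insert, not_or] at hcM'
  have hci : c ≠ i := by rintro rfl; exact hc hii
  rcases H.gap c hci hcM'.1 with h | h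
  · exact absurd (hA c h hcM'.2) hc
  · have hi := ih (insert c S) (by simp [hiS, hci.symm]) (by simp [hiS', hcM'.1, h.ne])
      (by rw [Finset.card_insert_of_notMem hcM'.2]; omega) (by rwa [Finset.insert_comm])
    refine div_aux (H.ppos (by rwa [Finset.insert_comm])) hi ?_ H.alpha (H.pos _) (H.pos _)
    have h3 := P2 A S hiS hiS' hcM'.2 H.lt h
    rw [hii] at h3
    linarith

/-- levels above the base -/
lemma KeyData.down (H : KeyData A i i' k k' α β) : ∀ (q : ℕ) (S : Finset (Fin n)), i ∉ S → i' ∉ S →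
    S.card = k + q → pl A (insert i' S) ≠ 0 → 
    α * pl A (insert i' S) ≤ β * pl A (insert i S) := by
  intro q
  induction q with
  | zero =>
    intro S hiS hiS' hk h0
    exact H.base _ S hiS hiS' (by omega) rfl h0
  | succ q ih =>
  intro S hiS hiS' hk h0
  have hgap : ∀ r ∈ S, r < i ∨ i' < r := fun r hr =>
    H.gap r (fun h => hiS (h ▸ hr)) (fun h => hiS' (h ▸ hr))
  have hcM : (insert i' S).card = S.card + 1 := Finset.card_insert_of_notMem hiS'
  have hp := H.ppos h0
  by_cases hB : ∃ b ∈ S, i' < b ∧ pl A (insert i' (S.erase b)) ≠ 0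
  · obtain ⟨b, hbS, hb, hne⟩ := hB
    have hbR : b ∉ S.erase b := by simp
    have hiR : i ∉ S.erase b := fun h => hiS (Finset.mem_of_mem_erase h)
    have hiR' : i' ∉ S.erase b := fun h => hiS' (Finset.mem_of_mem_erase h)
    have hi := ih (S.erase b) hiR hiR'
      (by rw [Finset.card_erase_of_mem hbS]; omega) hne
    refine div_aux (H.ppos hne) hi ?_ H.alpha (H.pos _) (H.pos _)
    have h3 := P2 A (S.erase b) hiR hiR' hbR H.lt hb
    rw [Finset.insert_erase hbS] at h3
    have := mul_nonneg (H.pos S) (H.pos (insert i (insert i' (S.erase b))))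
    linarith
  push Not at hB
  have hS0 : pl A S = 0 := by
    by_contra hne
    have hF := H.F1 _ (card_le_n S) (by omega)
    obtain ⟨b, hbS, hbT, hb⟩ := exch A S (S.filter (fun x => x < i)) rfl (card_le_n S) hne i (by
      intro hin
      apply hF
      refine Submodule.span_mono (Set.image_mono ?_) hin
      intro x hx
      simp at hx
      exact hx.2)
    have hbi : i' < b := by
      rcases hgap b hbS with h | h
      · exact absurd (by simp [hbS, h]) hbT
      · exact h
    have hbR : b ∉ S.erase b := by simp
    have hiR : i ∉ S.erase b := fun h => hiS (Finset.mem_of_mem_erase h)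
    have hiR' : i' ∉ S.erase b := fun h => hiS' (Finset.mem_of_mem_erase h)
    have h3 := P2 A (S.erase b) hiR hiR' hbR H.lt hbi
    rw [Finset.insert_erase hbS, hB b hbS hbi] at h3
    have := mul_nonneg (H.pos S) (H.pos (insert i (insert i' (S.erase b))))
    have := mul_pos (H.ppos hb) hp
    linarith
  obtain ⟨c, hcM', hc⟩ := del_one A (insert i' S) S.card hcM h0
  rw [Finset.mem_insert] at hcM'
  rcases hcM' with rfl | hcS
  · rw [Finset.erase_insert hiS'] at hc
    exact absurd hS0 hc
  · have hci' : c ≠ i' := fun h => hiS' (h ▸ hcS)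
    rw [Finset.erase_insert_of_ne hci'.symm] at hc
    have hci : c < i := by
      rcases hgap c hcS with h | h
      · exact h
      · exact absurd (hB c hcS h) hc
    have hcR : c ∉ S.erase c := by simp
    have hiR : i ∉ S.erase c := fun h => hiS (Finset.mem_of_mem_erase h)
    have hiR' : i' ∉ S.erase c := fun h => hiS' (Finset.mem_of_mem_erase h)
    have hi := ih (S.erase c) hiR hiR'
      (by rw [Finset.card_erase_of_mem hcS]; omega) hc
    refine div_aux (H.ppos hc) hi ?_ H.alpha (H.pos _) (H.pos _)
    have h3 := P2 A (S.erase c) hcR hiR hiR' hci H.lt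
    rw [Finset.insert_comm c i', Finset.insert_comm c i, Finset.insert_erase hcS, hS0] at h3
    linarith

lemma KeyData.claim_pos (H : KeyData A i i' k k' α β) (S : Finset (Fin n)) (hiS : i ∉ S) (hiS' : i' ∉ S)
    (h0 : pl A (insert i' S) ≠ 0) : α * pl A (insert i' S) ≤ β * pl A (insert i S) := by
  rcases le_total S.card k with h | h
  · exact H.up (k - S.card) S hiS hiS' (by omega) h0
  · exact H.down (S.card - k) S hiS hiS' (by omega) h0

lemma exists_basis (A : Matrix (Fin n) (Fin n) ℝ) (hA : A.det ≠ 0) (l : ℕ) (hl : l ≤ n) :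
    ∃ S : Finset (Fin n), S.card = l ∧ pl A S ≠ 0 := by
  induction l with
  | zero =>
    refine ⟨∅, rfl, ?_⟩
    rw [pl_eq A ∅ (l := 0) Finset.card_empty (Nat.zero_le _)]
    unfold DD vdet
    rw [Matrix.det_fin_zero]; norm_num
  | succ l ih =>
    obtain ⟨S, hS, hp⟩ := ih (by omega)
    obtain ⟨u, hu, hup⟩ := ext_one A hA S (by omega) hp
    exact ⟨insert u S, by rw [Finset.card_insert_of_notMem hu, hS], hup⟩

lemma KeyData.beta (H : KeyData A i i' k k' α β) : 0 ≤ β := by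
  by_contra hneg
  push Not at hneg
  have hkk := H.kk
  have hkn := H.kn
  have hz : ∀ S : Finset (Fin n), i ∉ S → i' ∉ S → pl A (insert i' S) = 0 := by
    intro S h1 h2
    by_contra hne
    have h3 := H.claim_pos S h1 h2 hne
    have h4 := mul_pos H.alpha (H.ppos hne)
    have h5 := mul_nonneg (neg_nonneg.2 hneg.le) (H.pos (insert i S))
    linarith
  have main : ∀ q (S : Finset (Fin n)), i ∉ S → S.card = k → (S.filter (fun x => ¬ x < i)).card = q →
      pl A (insert i S) = 0 := by
    intro q
    induction q using Nat.strong_induction_on with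
    | _ q ih =>
    intro S hiS hk hq
    by_contra hne
    have hlev : S.card + 1 ≤ n := by omega
    obtain ⟨u, hu, huS, hup⟩ := ext_span A S hlev (insert i' {a | a < i}) i hiS (by
        have h1 := H.F2 _ hlev (by omega)
        have h2 : β • tcol A hlev i ∈ Submodule.span ℝ (tcol A hlev '' (insert i' {a | a < i})) := by
          have e : β • tcol A hlev i = α • tcol A hlev i' - (α • tcol A hlev i' - β • tcol A hlev i) := by simp
          rw [e]
          refine Submodule.sub_mem _ ?_ (Submodule.span_mono (Set.image_mono (Set.subset_insert _ _)) h1)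
          exact Submodule.smul_mem _ _ (Submodule.subset_span ⟨i', by simp, rfl⟩)
        have := Submodule.smul_mem _ β⁻¹ h2
        rwa [smul_smul, inv_mul_cancel₀ hneg.ne, one_smul] at this) hne
    rcases hu with rfl | hu
    · exact hup (hz S hiS huS)
    · have hui : u < i := hu
      have hF := H.F1 _ hlev (by omega)
      obtain ⟨b, hbM, hbT, hb⟩ := exch A (insert u S) ((insert u S).filter (fun x => x < i))
        (Finset.card_insert_of_notMem huS) hlev hup i (by
          intro hin
          apply hF
          refine Submodule.span_mono (Set.image_mono ?_) hin
          intro x hx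
          simp only [Finset.coe_filter, Set.mem_ofPred_eq] at hx
          exact hx.2)
      have hbi : ¬ b < i := fun h => hbT (by rw [Finset.mem_filter]; exact ⟨hbM, h⟩)
      have hbu : b ≠ u := by rintro rfl; exact hbi hui
      have hbS : b ∈ S := (Finset.mem_insert.1 hbM).resolve_left hbu
      rw [Finset.erase_insert_of_ne hbu.symm] at hb
      have huR : u ∉ S.erase b := fun h => huS (Finset.mem_of_mem_erase h)
      refine hb (ih _ ?_ (insert u (S.erase b)) ?_ ?_ rfl)
      · rw [Finset.filter_insert, if_neg (by simpa using hui), ← hq, Finset.filter_erase]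
        refine Finset.card_erase_lt_of_mem ?_
        rw [Finset.mem_filter]; exact ⟨hbS, hbi⟩
      · simp [hui.ne', hiS]
      · rw [Finset.card_insert_of_notMem huR, Finset.card_erase_add_one hbS, hk]
  obtain ⟨M, hM, hMp⟩ := exists_basis A H.det (k+1) (by omega)
  by_cases hiM : i ∈ M
  · have := main _ (M.erase i) (by simp) (by rw [Finset.card_erase_of_mem hiM]; omega) rfl
    rw [Finset.insert_erase hiM] at this
    exact hMp this
  · have hlev : k + 1 ≤ n := by omega
    have hF := H.F1 _ hlev (by omega)
    obtain ⟨b, hbM, hbT, hb⟩ := exch A M ∅ hM hlev hMp i (by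
          intro hin
          apply hF
          refine Submodule.span_mono (Set.image_mono ?_) hin
          intro x hx
          simp at hx)
    exact hb (main _ (M.erase b) (fun h => hiM (Finset.mem_of_mem_erase h))
      (by rw [Finset.card_erase_of_mem hbM]; omega) rfl)

theorem KeyData.claim (H : KeyData A i i' k k' α β) (S : Finset (Fin n)) (hiS : i ∉ S) (hiS' : i' ∉ S) :
    α * pl A (insert i' S) ≤ β * pl A (insert i S) := by
  by_cases h0 : pl A (insert i' S) = 0
  · rw [h0, mul_zero]
    exact mul_nonneg H.beta (H.pos _)
  · exact H.claim_pos S hiS hiS' h0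

end key

lemma pl_colstep (A N : Matrix (Fin n) (Fin n) ℝ) (i i' : Fin n) (hlt : i < i')
    (gap : ∀ x, x ≠ i → x ≠ i' → x < i ∨ i' < x) (p : ℝ)
    (hNi : ∀ a, N a i = p * A a i - A a i') (hNi' : ∀ a, N a i' = A a i)
    (hNo : ∀ a x, x ≠ i → x ≠ i' → N a x = A a x)
    (hA : ∀ S, 0 ≤ pl A S)
    (hc : ∀ S, i ∉ S → i' ∉ S → pl A (insert i' S) ≤ p * pl A (insert i S)) :
    ∀ S, 0 ≤ pl N S := by
  have tR : ∀ {l : ℕ} (h : l ≤ n) (R : Finset (Fin n)), i ∉ R → i' ∉ R →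
      (fun b => tcol N h (R.orderEmbOfFin rfl b)) = (fun b => tcol A h (R.orderEmbOfFin rfl b)) := by
    intro l h R h1 h2
    funext b a
    have := Finset.orderEmbOfFin_mem R rfl b
    exact hNo _ _ (fun h => h1 (h ▸ this)) (fun h => h2 (h ▸ this))
  have ti : ∀ {l : ℕ} (h : l ≤ n), tcol N h i = p • tcol A h i - tcol A h i' := by
    intro l h; funext a; simp [tcol, hNi]
  have ti' : ∀ {l : ℕ} (h : l ≤ n), tcol N h i' = tcol A h i := by
    intro l h; funext a; simp [tcol, hNi']
  have hep : ∀ R : Finset (Fin n), i ∉ R → i' ∉ R → ep R i = ep R i' := by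
    intro R h1 h2
    refine ep_eq R i i' hlt fun r hr => gap r ?_ ?_
    · rintro rfl; exact h1 hr
    · rintro rfl; exact h2 hr
  intro S
  by_cases h1 : i ∈ S <;> by_cases h2 : i' ∈ S
  · set R := (S.erase i).erase i' with hR
    have hS : S = insert i (insert i' R) := by
      rw [hR, Finset.insert_erase (by simp [h2, hlt.ne']), Finset.insert_erase h1]
    have h3 : i ∉ R := by simp [hR]
    have h4 : i' ∉ R := by simp [hR]
    have h := card2 h3 h4 hlt.ne
    have := hA S
    rw [hS] at this ⊢
    rw [pl_insert2 _ R i i' h3 h4 hlt h, DD_cons2] at this ⊢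
    rw [tR h R h3 h4, ti, ti']
    obtain ⟨φ, hφ⟩ := vdet_lin (Fin.cons (tcol A h i) (fun b => tcol A h (R.orderEmbOfFin rfl b)) : Fin (R.card+1) → _)
    rw [← hφ, map_sub, map_smul, hφ, hφ, vdet_eq_zero _ 0 1 (by simp) (by simp),
      vdet_swap2 (tcol A h i')]
    simpa using this
  · set R := (S.erase i) with hR
    have hS : S = insert i R := by
      rw [hR, Finset.insert_erase h1]
    have h3 : i ∉ R := by simp [hR]
    have h4 : i' ∉ R := by simp [hR, h2]
    have h := card1 h3
    have := hc R h3 h4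
    rw [hS]
    rw [pl_insert _ R i h3 h, DD_cons1] at this ⊢
    rw [pl_insert _ R i' h4 h, DD_cons1, ← hep R h3 h4] at this
    rw [tR h R h3 h4, ti]
    obtain ⟨φ, hφ⟩ := vdet_lin (fun b => tcol A h (R.orderEmbOfFin rfl b))
    rw [← hφ] at this ⊢
    rw [← hφ] at this
    rw [map_sub, map_smul, smul_eq_mul]
    linarith
  · set R := (S.erase i') with hR
    have hS : S = insert i' R := by
      rw [hR, Finset.insert_erase h2]
    have h3 : i ∉ R := by simp [hR, h1]
    have h4 : i' ∉ R := by simp [hR]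
    have h := card1 h3
    have := hA (insert i R)
    rw [hS]
    rw [pl_insert _ R i h3 h, DD_cons1] at this
    rw [pl_insert _ R i' h4 h, DD_cons1, ← hep R h3 h4]
    rw [tR h R h3 h4, ti']
    exact this
  · have := hA S
    unfold pl DD at this ⊢
    rwa [tR _ S h1 h2]

lemma pl_lower (Lw M : Matrix (Fin n) (Fin n) ℝ) (hd : ∀ a, Lw a a = 1)
    (hL : ∀ a b, a < b → Lw a b = 0) (S : Finset (Fin n)) : pl (Lw * M) S = pl M S := by
  unfold pl DD vdet
  set h := card_le_n S
  have : (Matrix.of fun b => tcol (Lw * M) h (S.orderEmbOfFin rfl b)) =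
      (Matrix.of fun b => tcol M h (S.orderEmbOfFin rfl b)) *
        (Lw.submatrix (Fin.castLE h) (Fin.castLE h))ᵀ := by
    ext b a
    simp only [Matrix.of_apply, tcol, Matrix.mul_apply, Matrix.transpose_apply, Matrix.submatrix_apply]
    rw [← Finset.sum_subset (Finset.subset_univ (Finset.univ.map (Fin.castLEEmb h)))]
    · rw [Finset.sum_map]
      exact Finset.sum_congr rfl fun x _ => mul_comm _ _
    · intro x _ hx
      rw [hL, zero_mul]
      simp only [Finset.mem_map, Finset.mem_univ, true_and, not_exists] at hx
      rw [Fin.lt_def]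
      by_contra hc
      refine hx ⟨x, ?_⟩ ?_
      · have := a.2
        simp at hc; omega
      · ext; simp
  have h1 : (Lw.submatrix (Fin.castLE h) (Fin.castLE h)).det = 1 := by
    rw [Matrix.det_of_isLowerTriangular]
    · simp [hd]
    · intro a b hab
      exact hL _ _ (by simpa using hab)
  rw [this, Matrix.det_mul, Matrix.det_transpose, h1, mul_one]

lemma pl_one (S : Finset (Fin n)) : 0 ≤ pl (1 : Matrix (Fin n) (Fin n) ℝ) S := by
  by_cases hS : ∀ b : Fin S.card, S.orderEmbOfFin rfl b = Fin.castLE (card_le_n S) b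
  · unfold pl DD vdet
    have : (Matrix.of fun b => tcol (1 : Matrix (Fin n) (Fin n) ℝ) (card_le_n S) (S.orderEmbOfFin rfl b)) = 1 := by
      ext b a
      simp only [Matrix.of_apply, tcol, hS, Matrix.one_apply, Fin.castLE_inj]
      simp [eq_comm]
    rw [this]; simp
  · have : ∃ x ∈ S, S.card ≤ (x : ℕ) := by
      by_contra hc
      push Not at hc
      apply hS
      intro b
      have hsub : S = Finset.univ.map (Fin.castLEEmb (card_le_n S)) := by
        apply Finset.eq_of_subset_of_card_le
        · intro x hx
          simp only [Finset.mem_map, Finset.mem_univ, true_and]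
          exact ⟨⟨x, hc x hx⟩, by ext; simp⟩
        · simp
      have := Finset.orderEmbOfFin_unique (s := S) rfl (f := Fin.castLE (card_le_n S)) (fun x => by
        have := Finset.mem_map_of_mem (Fin.castLEEmb (card_le_n S)) (Finset.mem_univ x)
        exact hsub.ge this) (Fin.strictMono_castLE _)
      rw [← this]
    obtain ⟨x, hx, hxS⟩ := this
    rw [← mem_range_emb] at hx
    obtain ⟨b, hb⟩ := hx
    unfold pl DD vdet
    rw [Matrix.det_eq_zero_of_row_eq_zero b]
    intro a
    simp only [Matrix.of_apply, tcol, hb, Matrix.one_apply]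
    rw [if_neg]
    intro hh
    rw [← hh] at hxS
    have := a.2
    simp at hxS
    omega

lemma minor_eq_pl (A : Matrix (Fin n) (Fin n) ℝ) (J : Finset (Fin n)) :
    minor A (univ.filter fun i : Fin n => (i : ℕ) < J.card) J = pl A J := by
  have hI : (univ.filter fun i : Fin n => (i : ℕ) < J.card) = Finset.univ.map (Fin.castLEEmb (card_le_n J)) := by
    ext x
    simp only [Finset.mem_filter, Finset.mem_map, Finset.mem_univ, true_and]
    constructor
    · intro hx; exact ⟨⟨x, hx⟩, by ext; simp⟩
    · rintro ⟨a, rfl⟩; simp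
  have hc : (univ.filter fun i : Fin n => (i : ℕ) < J.card).card = J.card := by
    rw [hI]; simp
  generalize hIe : (univ.filter fun i : Fin n => (i : ℕ) < J.card) = I at *
  unfold minor
  rw [dif_pos hc, pl_eq A J hc.symm (hc ▸ card_le_n J), DD, vdet, ← Matrix.det_transpose]
  congr 1
  ext a b
  simp only [Matrix.transpose_apply, Matrix.of_apply, tcol]
  congr 1
  have := Finset.orderEmbOfFin_unique (s := I) rfl (f := Fin.castLE (hc ▸ card_le_n J)) (fun x => by
        refine hIe.le (Finset.mem_filter.2 ⟨Finset.mem_univ _, ?_⟩)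
        have := x.2
        simp only [Fin.val_castLE]; omega) (Fin.strictMono_castLE _)
  rw [← this]

lemma pl_diag (A D : Matrix (Fin n) (Fin n) ℝ) (d : Fin n → ℝ) (hD : ∀ a j, D a j = A a j * d j)
    (S : Finset (Fin n)) : ∃ c : Fin S.card → Fin n, pl D S = (∏ b, d (c b)) * pl A S := by
  refine ⟨S.orderEmbOfFin rfl, ?_⟩
  unfold pl DD vdet
  rw [← Matrix.det_mul_column]
  congr 1
  ext b a
  simp only [Matrix.of_apply, tcol, hD]
  exact mul_comm _ _

def sg (v : Equiv.Perm (Fin n)) (b : Fin n) : ℝ :=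
  (-1 : ℝ) ^ (univ.filter fun k : Fin n => b < k ∧ v k < v b).card

lemma sg_sq (v : Equiv.Perm (Fin n)) (b : Fin n) : sg v b * sg v b = 1 := by
  unfold sg
  rw [← mul_pow]; norm_num

lemma sg_ne (v : Equiv.Perm (Fin n)) (b : Fin n) : sg v b ≠ 0 := by
  intro h
  have := sg_sq v b
  rw [h] at this; norm_num at this

lemma pdot_apply (v : Equiv.Perm (Fin n)) (a b : Fin n) :
    (pdot v : Matrix (Fin n) (Fin n) ℝ) a b = if a = v b then sg v b else 0 := rfl

lemma pdot_mul (v : Equiv.Perm (Fin n)) (B : Matrix (Fin n) (Fin n) ℝ) (c j : Fin n) :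
    (pdot v * B : Matrix (Fin n) (Fin n) ℝ) (v c) j = sg v c * B c j := by
  rw [Matrix.mul_apply, Finset.sum_eq_single c]
  · simp [pdot_apply]
  · intro b _ hb
    simp [pdot_apply, hb.symm]
  · simp

lemma pdot_det (v : Equiv.Perm (Fin n)) (B : Matrix (Fin n) (Fin n) ℝ) (hB : B.det ≠ 0) :
    (pdot v * B).det ≠ 0 := by
  have h := Matrix.det_permute v (pdot v * B)
  have h2 : (pdot v * B).submatrix v id = Matrix.of fun c j => sg v c * B c j := by
    ext c j
    simp [pdot_mul]
  rw [h2, Matrix.det_mul_column] at h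
  intro h0
  rw [h0, mul_zero] at h
  exact mul_ne_zero (Finset.prod_ne_zero_iff.2 fun c _ => sg_ne v c) hB h

lemma upspan (B : Matrix (Fin n) (Fin n) ℝ) (hB : ∀ a b, b < a → B a b = 0) (hd : ∀ a, 0 < B a a)
    (s : ℕ) : ∀ x : Fin n → ℝ, (∀ a : Fin n, s ≤ (a : ℕ) → x a = 0) →
      x ∈ Submodule.span ℝ ((fun j a => B a j) '' {a : Fin n | (a : ℕ) < s}) := by
  induction s with
  | zero =>
    intro x hx
    have : x = 0 := funext fun a => hx a (Nat.zero_le _)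
    rw [this]; exact Submodule.zero_mem _
  | succ s ih =>
    intro x hx
    have hmono : Submodule.span ℝ ((fun j a => B a j) '' {a : Fin n | (a : ℕ) < s}) ≤
        Submodule.span ℝ ((fun j a => B a j) '' {a : Fin n | (a : ℕ) < s + 1}) := by
      refine Submodule.span_mono (Set.image_mono ?_)
      intro a ha
      exact Nat.lt_succ_of_lt ha
    by_cases hs : s < n
    · set j : Fin n := ⟨s, hs⟩ with hj
      have h1 := ih (x - (x j / B j j) • (fun a => B a j)) (by
        intro a ha
        rcases Nat.lt_or_ge s a with h | h
        · simp [hx a h, hB a j (by rw [Fin.lt_def]; exact h)]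
        · have : a = j := by ext; simp [hj]; omega
          rw [this]
          have := (hd j).ne'
          simp; field_simp; simp)
      have h2 : (fun a => B a j) ∈ Submodule.span ℝ ((fun j a => B a j) '' {a : Fin n | (a : ℕ) < s + 1}) :=
        Submodule.subset_span ⟨j, by simp [hj], rfl⟩
      have := Submodule.add_mem _ (hmono h1) (Submodule.smul_mem _ (x j / B j j) h2)
      simpa using this
    · refine hmono (ih x fun a ha => ?_)
      have := a.2
      omega

lemma keyData_of (v : Equiv.Perm (Fin n)) (B : Matrix (Fin n) (Fin n) ℝ)
    (hB : ∀ a b, b < a → B a b = 0) (hd : ∀ a, 0 < B a a)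
    (hpos : ∀ S, 0 ≤ pl (pdot v * B) S) (i i' : Fin n) (hi : (i : ℕ) + 1 = i') (hv : v i < v i') :
    KeyData (pdot v * B) i i' (v i) (v i') (B i i) (B i i') where
  det := by
    apply pdot_det
    rw [Matrix.det_of_isUpperTriangular]
    · exact Finset.prod_ne_zero_iff.2 fun a _ => (hd a).ne'
    · intro a b hab
      exact hB _ _ hab
  pos := hpos
  lt := by rw [Fin.lt_def]; omega
  gap := by
    intro x h1 h2
    simp only [Fin.lt_def, ne_eq, Fin.ext_iff] at *
    omega
  kk := hv
  kn := (v i').2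
  alpha := hd i
  F1 := by
    intro l h hl hmem
    have key : ∀ j, tcol (pdot v * B) h j ⟨v i, hl⟩ = sg v i * B i j := by
      intro j
      exact pdot_mul v B i j
    have : Submodule.span ℝ (tcol (pdot v * B) h '' {a | a < i}) ≤
        LinearMap.ker (LinearMap.proj (R := ℝ) (φ := fun _ : Fin l => ℝ) ⟨v i, hl⟩) := by
      rw [Submodule.span_le]
      rintro _ ⟨a, ha, rfl⟩
      simp only [SetLike.mem_coe, LinearMap.mem_ker, LinearMap.proj_apply]
      rw [key, hB i a ha, mul_zero]
    have := this hmem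
    simp only [LinearMap.mem_ker, LinearMap.proj_apply] at this
    rw [key] at this
    exact mul_ne_zero (sg_ne v i) (hd i).ne' this
  F2 := by
    intro l h hl
    let T : (Fin n → ℝ) →ₗ[ℝ] (Fin l → ℝ) :=
      { toFun := fun x a => sg v (v.symm (Fin.castLE h a)) * x (v.symm (Fin.castLE h a))
        map_add' := by intro x y; funext a; simp [mul_add]
        map_smul' := by intro c x; funext a; simp; ring }
    have hT : ∀ j, tcol (pdot v * B) h j = T (fun a => B a j) := by
      intro j
      funext a
      have := pdot_mul v B (v.symm (Fin.castLE h a)) j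
      rw [Equiv.apply_symm_apply] at this
      exact this
    have hTe : T (Pi.single i' 1) = 0 := by
      funext a
      have : v.symm (Fin.castLE h a) ≠ i' := by
        intro hh
        rw [Equiv.symm_apply_eq] at hh
        have h2 := congrArg Fin.val hh
        have := a.2
        simp at h2
        omega
      simp [T, this]
    have him : tcol (pdot v * B) h '' {a | a < i} = T '' ((fun j a => B a j) '' {a : Fin n | (a : ℕ) < i}) := by
      rw [Set.image_image]
      exact Set.image_congr fun a _ => hT a
    rw [him, ← Submodule.map_span]
    refine ⟨B i i • (fun a => B a i') - B i i' • (fun a => B a i) - (B i i * B i' i') • Pi.single i' 1, ?_, ?_⟩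
    · refine upspan B hB hd _ _ fun a ha => ?_
      rcases Nat.lt_or_ge (i' : ℕ) a with h1 | h1
      · have h2 : a ≠ i' := by rw [ne_eq, Fin.ext_iff]; omega
        simp [hB a i' (by rw [Fin.lt_def]; omega), hB a i (by rw [Fin.lt_def]; omega), h2]
      · by_cases h2 : a = i'
        · subst h2
          simp [hB a i (by rw [Fin.lt_def]; omega)]
        · have h3 : a = i := by
            rw [Fin.ext_iff] at h2 ⊢; omega
          subst h3
          simp [h2]; ring
    · rw [map_sub, map_smul, hTe, map_sub, map_smul, map_smul, hT, hT]
      simp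

lemma xmat_apply (i i' : Fin n) (hi : (i : ℕ) + 1 = i') (t : ℝ) (a b : Fin n) :
    (xmat (i' : ℕ) t : Matrix (Fin n) (Fin n) ℝ) a b =
      (if a = b then 1 else 0) + (if a = i ∧ b = i' then t else 0) := by
  simp only [xmat, Matrix.of_apply, Fin.ext_iff]
  split_ifs <;> first | omega | simp

lemma sdot_apply (i i' : Fin n) (hi : (i : ℕ) + 1 = i') (a b : Fin n) :
    (sdot (i' : ℕ) : Matrix (Fin n) (Fin n) ℝ) a b =
      if b = i then (if a = i' then -1 else 0) else if b = i' then (if a = i then 1 else 0)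
      else if a = b then 1 else 0 := by
  simp only [sdot, Matrix.of_apply, Fin.ext_iff]
  split_ifs <;> first | omega | rfl

lemma sdot_apply' (i i' : Fin n) (hi : (i : ℕ) + 1 = i') (a b : Fin n) :
    (sdot (i' : ℕ) : Matrix (Fin n) (Fin n) ℝ) a b =
      if a = i' then (if b = i then -1 else 0) else if a = i then (if b = i' then 1 else 0)
      else if a = b then 1 else 0 := by
  simp only [sdot, Matrix.of_apply, Fin.ext_iff]
  split_ifs <;> first | omega | rfl

section mats
variable (M : Matrix (Fin n) (Fin n) ℝ) (i i' : Fin n)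

lemma mul_xmat (hi : (i : ℕ) + 1 = i') (t : ℝ) (a b : Fin n) :
    (M * xmat (i' : ℕ) t : Matrix (Fin n) (Fin n) ℝ) a b = M a b + if b = i' then t * M a i else 0 := by
  simp only [Matrix.mul_apply, xmat_apply i i' hi, mul_add, Finset.sum_add_distrib]
  by_cases h : b = i' <;> simp [h, mul_comm]

lemma xmat_mul (hi : (i : ℕ) + 1 = i') (t : ℝ) (a b : Fin n) :
    (xmat (i' : ℕ) t * M : Matrix (Fin n) (Fin n) ℝ) a b = M a b + if a = i then t * M i' b else 0 := by
  simp only [Matrix.mul_apply, xmat_apply i i' hi, add_mul, Finset.sum_add_distrib]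
  by_cases h : a = i <;> simp [h]

lemma xmatT_mul (hi : (i : ℕ) + 1 = i') (t : ℝ) (a b : Fin n) :
    ((xmat (i' : ℕ) t : Matrix (Fin n) (Fin n) ℝ)ᵀ * M) a b = M a b + if a = i' then t * M i b else 0 := by
  simp only [Matrix.mul_apply, Matrix.transpose_apply, xmat_apply i i' hi, add_mul, Finset.sum_add_distrib]
  by_cases h : a = i' <;> simp [h]

lemma mul_sdot (hi : (i : ℕ) + 1 = i') (a b : Fin n) :
    (M * sdot (i' : ℕ) : Matrix (Fin n) (Fin n) ℝ) a b = if b = i then - M a i' else if b = i' then M a i else M a b := by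
  simp only [Matrix.mul_apply, sdot_apply i i' hi]
  split_ifs <;> simp

lemma sdotT_mul (hi : (i : ℕ) + 1 = i') (a b : Fin n) :
    ((sdot (i' : ℕ) : Matrix (Fin n) (Fin n) ℝ)ᵀ * M) a b =
      if a = i then - M i' b else if a = i' then M i b else M a b := by
  simp only [Matrix.mul_apply, Matrix.transpose_apply, sdot_apply i i' hi]
  split_ifs <;> simp

lemma mul_sdotT (hi : (i : ℕ) + 1 = i') (a b : Fin n) :
    (M * (sdot (i' : ℕ) : Matrix (Fin n) (Fin n) ℝ)ᵀ) a b =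
      if b = i' then - M a i else if b = i then M a i' else M a b := by
  simp only [Matrix.mul_apply, Matrix.transpose_apply, sdot_apply' i i' hi]
  split_ifs <;> simp

lemma sdot_mul_T (hi : (i : ℕ) + 1 = i') :
    (sdot (i' : ℕ) : Matrix (Fin n) (Fin n) ℝ) * (sdot (i' : ℕ))ᵀ = 1 := by
  have hne : i ≠ i' := by rw [ne_eq, Fin.ext_iff]; omega
  ext a b
  rw [mul_sdotT _ i i' hi]
  simp only [sdot_apply' i i' hi, Matrix.one_apply]
  by_cases h1 : b = i' <;> by_cases h2 : b = i <;> by_cases h3 : a = i' <;> by_cases h4 : a = i <;>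
    simp_all [eq_comm]

lemma xmat_neg_mul (hi : (i : ℕ) + 1 = i') (p : ℝ) :
    (xmat (i' : ℕ) (-p) : Matrix (Fin n) (Fin n) ℝ) * xmat (i' : ℕ) p = 1 := by
  have hne : i ≠ i' := by rw [ne_eq, Fin.ext_iff]; omega
  ext a b
  rw [mul_xmat _ i i' hi]
  simp only [xmat_apply i i' hi, Matrix.one_apply]
  by_cases h1 : b = i' <;> by_cases h4 : a = i <;>
    simp_all

lemma det_xmat (hi : (i : ℕ) + 1 = i') (t : ℝ) :
    (xmat (i' : ℕ) t : Matrix (Fin n) (Fin n) ℝ).det = 1 := by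
  rw [Matrix.det_of_isUpperTriangular]
  · refine Finset.prod_eq_one fun a _ => ?_
    simp [xmat]
  · intro a b hab
    have : b < a := hab
    rw [xmat_apply i i' hi, if_neg this.ne', if_neg, add_zero]
    rintro ⟨rfl, rfl⟩
    rw [Fin.lt_def] at this
    omega

end mats

lemma swap_other {i i' b : Fin n} (h1 : b ≠ i) (h2 : b ≠ i') : Equiv.swap i i' b = b :=
  Equiv.swap_apply_of_ne_of_ne h1 h2

lemma swap_lt {i i' : Fin n} (hi : (i : ℕ) + 1 = i') {a b : Fin n} (hab : a < b)
    (h : ¬ (a = i ∧ b = i')) : Equiv.swap i i' a < Equiv.swap i i' b := by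
  rw [Equiv.swap_apply_def, Equiv.swap_apply_def]
  simp only [Fin.ext_iff, Fin.lt_def] at *
  split_ifs <;> omega

lemma sg_swap (v : Equiv.Perm (Fin n)) (i i' : Fin n) (hi : (i : ℕ) + 1 = i') (hv : v i < v i') :
    sg (v * Equiv.swap i i') i' = sg v i ∧ sg (v * Equiv.swap i i') i = - sg v i' ∧
    ∀ b, b ≠ i → b ≠ i' → sg (v * Equiv.swap i i') b = sg v b := by
  have hne : i ≠ i' := by rw [ne_eq, Fin.ext_iff]; omega
  refine ⟨?_, ?_, ?_⟩
  · unfold sg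
    congr 2
    ext k
    simp only [Finset.mem_filter, Finset.mem_univ, true_and, Equiv.Perm.mul_apply, Equiv.swap_apply_right]
    constructor
    · rintro ⟨h1, h2⟩
      have h3 : k ≠ i' := h1.ne'
      have h4 : k ≠ i := by rw [ne_eq, Fin.ext_iff]; rw [Fin.lt_def] at h1; omega
      rw [swap_other h4 h3] at h2
      exact ⟨by rw [Fin.lt_def] at *; omega, h2⟩
    · rintro ⟨h1, h2⟩
      have h3 : k ≠ i' := by rintro rfl; exact absurd h2 (not_lt.2 hv.le)
      have h4 : k ≠ i := h1.ne'
      rw [swap_other h4 h3]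
      refine ⟨?_, h2⟩
      rw [ne_eq, Fin.ext_iff] at h3 h4; rw [Fin.lt_def] at *; omega
  · unfold sg
    rw [← neg_one_mul ((-1 : ℝ) ^ _), ← pow_succ']
    congr 1
    rw [← Finset.card_insert_of_notMem (a := i') (by simp)]
    congr 1
    ext k
    simp only [Finset.mem_filter, Finset.mem_univ, true_and, Equiv.Perm.mul_apply, Equiv.swap_apply_left,
      Finset.mem_insert]
    by_cases h3 : k = i'
    · subst h3
      simp only [Equiv.swap_apply_right, true_or, iff_true]
      exact ⟨by rw [Fin.lt_def] at *; omega, hv⟩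
    · by_cases h4 : k = i
      · subst h4
        simp [h3]
        intro h; rw [Fin.lt_def] at h; omega
      · rw [swap_other h4 h3]
        simp only [h3, false_or]
        refine and_congr_left fun _ => ?_
        rw [Fin.ext_iff] at h3 h4
        simp only [Fin.lt_def]; omega
  · intro b h1 h2
    unfold sg
    congr 1
    refine Finset.card_bij (fun k _ => Equiv.swap i i' k) ?_ ?_ ?_
    · intro k hk
      simp only [Finset.mem_filter, Finset.mem_univ, true_and, Equiv.Perm.mul_apply, swap_other h1 h2] at hk ⊢
      refine ⟨?_, hk.2⟩
      have := swap_lt hi hk.1 (fun h => h1 h.1)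
      rwa [swap_other h1 h2] at this
    · intro a _ b _ h
      exact (Equiv.swap i i').injective h
    · intro k hk
      refine ⟨Equiv.swap i i' k, ?_, by simp⟩
      simp only [Finset.mem_filter, Finset.mem_univ, true_and, Equiv.Perm.mul_apply, swap_other h1 h2] at hk ⊢
      refine ⟨?_, by simpa using hk.2⟩
      have := swap_lt hi hk.1 (fun h => h1 h.1)
      rwa [swap_other h1 h2] at this

lemma pdot_swap (v : Equiv.Perm (Fin n)) (i i' : Fin n) (hi : (i : ℕ) + 1 = i') (hv : v i < v i') :
    (pdot (v * Equiv.swap i i') * (sdot (i' : ℕ))ᵀ : Matrix (Fin n) (Fin n) ℝ) = pdot v := by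
  obtain ⟨h1, h2, h3⟩ := sg_swap v i i' hi hv
  have hne : i ≠ i' := by rw [ne_eq, Fin.ext_iff]; omega
  ext a b
  rw [mul_sdotT _ i i' hi]
  simp only [pdot_apply, Equiv.Perm.mul_apply, h1, h2, Equiv.swap_apply_left, Equiv.swap_apply_right]
  by_cases hb : b = i'
  · subst hb; simp; split_ifs <;> simp
  · by_cases hb' : b = i
    · subst hb'; simp [hb]
    · simp [hb, hb', h3 b hb' hb, swap_other hb' hb]

lemma pdot_lower (v : Equiv.Perm (Fin n)) (i i' : Fin n) (hi : (i : ℕ) + 1 = i') (hv : v i < v i') (t : ℝ)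
    (M : Matrix (Fin n) (Fin n) ℝ) (S : Finset (Fin n)) :
    pl (pdot v * ((xmat (i' : ℕ) t)ᵀ * M)) S = pl (pdot v * M) S := by
  have hne : i ≠ i' := by rw [ne_eq, Fin.ext_iff]; omega
  have : pdot v * ((xmat (i' : ℕ) t : Matrix (Fin n) (Fin n) ℝ)ᵀ * M) =
      (1 + Matrix.single (v i') (v i) (sg v i' * t * sg v i)) * (pdot v * M) := by
    ext a j
    obtain ⟨c, rfl⟩ := v.surjective a
    rw [pdot_mul, xmatT_mul _ i i' hi, add_mul, one_mul, Matrix.add_apply, pdot_mul]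
    by_cases hc : c = i'
    · subst hc
      rw [Matrix.single_mul_apply_same, pdot_mul, if_pos rfl]
      linear_combination (- sg v c * t * M i j) * sg_sq v i
    · rw [Matrix.single_mul_apply_of_ne, if_neg hc]
      · simp
      · intro h; exact hc (v.injective h)
  rw [this]
  refine pl_lower _ _ ?_ ?_ S
  · intro a
    rw [Matrix.add_apply, Matrix.one_apply_eq, Matrix.single_apply, if_neg, add_zero]
    rintro ⟨h1, h2⟩
    exact hv.ne (h2.trans h1.symm)
  · intro a b hab
    rw [Matrix.add_apply, Matrix.one_apply_ne hab.ne, Matrix.single_apply, if_neg, add_zero]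
    rintro ⟨rfl, rfl⟩
    exact absurd hab (not_lt.2 hv.le)

def Inv (v wp : Equiv.Perm (Fin n)) (G W : Matrix (Fin n) (Fin n) ℝ) : Prop :=
  G.det ^ 2 = 1 ∧ W.det ^ 2 = 1 ∧ ∃ B L : Matrix (Fin n) (Fin n) ℝ,
    (∀ a b, b < a → B a b = 0) ∧ (∀ a, 0 < B a a) ∧ (∀ a, L a a = 1) ∧
    (∀ a b, a ≠ b → L a b ≠ 0 → b < a ∧ wp a < wp b) ∧ Gᵀ * W = B * L ∧
    ∀ S, 0 ≤ pl (pdot v * B) S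

def newL (i' : Fin n) (p : ℝ) (L : Matrix (Fin n) (Fin n) ℝ) : Matrix (Fin n) (Fin n) ℝ :=
  (sdot (i' : ℕ))ᵀ * (xmat (i' : ℕ) p * L) * sdot (i' : ℕ)

lemma stepL (wp : Equiv.Perm (Fin n)) (i i' : Fin n) (hi : (i : ℕ) + 1 = i') (hw : wp i < wp i')
    (L : Matrix (Fin n) (Fin n) ℝ) (p : ℝ) (hd : ∀ a, L a a = 1)
    (hL : ∀ a b, a ≠ b → L a b ≠ 0 → b < a ∧ wp a < wp b) :
    (∀ a, newL i' p L a a = 1) ∧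
    ∀ a b, a ≠ b → newL i' p L a b ≠ 0 →
      b < a ∧ (wp * Equiv.swap i i') a < (wp * Equiv.swap i i') b := by
  have hne : i ≠ i' := by rw [ne_eq, Fin.ext_iff]; omega
  have hlt : i < i' := by rw [Fin.lt_def]; omega
  have z1 : L i' i = 0 := by
    by_contra h
    exact absurd (hL _ _ hne.symm h).2 (not_lt.2 hw.le)
  have z2 : L i i' = 0 := by
    by_contra h
    exact absurd (hL _ _ hne h).1 (not_lt.2 hlt.le)
  have e : ∀ a b, newL i' p L a b =
      if a = i then (if b = i then 1 else if b = i' then 0 else - L i' b)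
      else if a = i' then (if b = i then -p else if b = i' then 1 else L i b + p * L i' b)
      else (if b = i then - L a i' else if b = i' then L a i else L a b) := by
    intro a b
    simp only [newL, mul_sdot _ i i' hi, sdotT_mul _ i i' hi, xmat_mul _ i i' hi]
    by_cases h1 : a = i
    · subst h1
      by_cases h2 : b = a
      · subst h2; simp [hne.symm, hd]
      · by_cases h3 : b = i'
        · subst h3; simp [h2, z1]
        · simp [h2, h3, hne.symm]
    · by_cases h1' : a = i'
      · subst h1'
        by_cases h2 : b = i
        · subst h2; simp [h1, hd, z2]
        · by_cases h3 : b = a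
          · subst h3; simp [h2, z1, hd]
          · simp [h2, h3, h1]
      · simp [h1, h1']
  constructor
  · intro a
    rw [e]
    by_cases h1 : a = i
    · simp [h1]
    · by_cases h2 : a = i'
      · simp [h2, hne.symm]
      · simp [h1, h2, hd]
  · intro a b hab h
    rw [e] at h
    simp only [Equiv.Perm.mul_apply]
    by_cases h1 : a = i
    · subst h1
      by_cases h2 : b = i'
      · subst h2; simp [hab.symm] at h
      · simp only [if_true, hab.symm, if_false, h2, neg_ne_zero, ne_eq] at h
        have := hL _ _ (Ne.symm h2) h
        rw [Equiv.swap_apply_left, swap_other hab.symm h2]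
        refine ⟨?_, this.2⟩
        have h3 := this.1
        rw [ne_eq, Fin.ext_iff] at hab
        rw [Fin.lt_def] at *; omega
    · by_cases h1' : a = i'
      · subst h1'
        by_cases h2 : b = i
        · subst h2
          rw [Equiv.swap_apply_left, Equiv.swap_apply_right]
          exact ⟨hlt, hw⟩
        · simp only [if_true, hab.symm, if_false, h2, ne_eq, h1] at h
          rw [Equiv.swap_apply_right, swap_other h2 hab.symm]
          by_cases h3 : L i b = 0
          · have h4 : L a b ≠ 0 := by
              intro h4; apply h; simp [h3, h4]
            have := hL _ _ hab h4
            exact ⟨this.1, hw.trans this.2⟩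
          · have := hL _ _ (Ne.symm h2) h3
            exact ⟨this.1.trans hlt, this.2⟩
      · by_cases h2 : b = i
        · subst h2
          simp only [h1, h1', if_true, if_false, neg_ne_zero, ne_eq] at h
          have := hL _ _ h1' h
          rw [Equiv.swap_apply_left, swap_other h1 h1']
          exact ⟨hlt.trans this.1, this.2⟩
        · by_cases h3 : b = i'
          · subst h3
            simp only [h1, h1', h2, if_true, if_false, ne_eq] at h
            have := hL _ _ h1 h
            rw [Equiv.swap_apply_right, swap_other h1 h1']
            refine ⟨?_, this.2⟩
            have h3 := this.1
            rw [Fin.ext_iff] at h1'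
            rw [Fin.lt_def] at *; omega
          · simp only [h1, h1', h2, h3, if_false] at h
            rw [swap_other h1 h1', swap_other h2 h3]
            exact hL _ _ hab h

def newC (i' : Fin n) (p : ℝ) (B : Matrix (Fin n) (Fin n) ℝ) : Matrix (Fin n) (Fin n) ℝ :=
  B * xmat (i' : ℕ) (-p) * sdot (i' : ℕ)

lemma newC_apply (i i' : Fin n) (hi : (i : ℕ) + 1 = i') (p : ℝ) (B : Matrix (Fin n) (Fin n) ℝ) (a b : Fin n) :
    newC i' p B a b = if b = i then p * B a i - B a i' else if b = i' then B a i else B a b := by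
  have hne : i ≠ i' := by rw [ne_eq, Fin.ext_iff]; omega
  simp only [newC, mul_sdot _ i i' hi, mul_xmat _ i i' hi]
  by_cases h1 : b = i
  · subst h1; simp; ring
  · by_cases h2 : b = i'
    · subst h2; simp [h1, hne]
    · simp [h1, h2]

lemma newC_newL (i i' : Fin n) (hi : (i : ℕ) + 1 = i') (p : ℝ) (B L : Matrix (Fin n) (Fin n) ℝ) :
    newC i' p B * newL i' p L = B * L * sdot (i' : ℕ) := by
  unfold newC newL
  calc _ = B * xmat (i' : ℕ) (-p) * (sdot (i' : ℕ) * (sdot (i' : ℕ))ᵀ) * xmat (i' : ℕ) p * L * sdot (i' : ℕ) := by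
        simp only [Matrix.mul_assoc]
    _ = B * (xmat (i' : ℕ) (-p) * xmat (i' : ℕ) p) * L * sdot (i' : ℕ) := by
        rw [sdot_mul_T i i' hi]; simp only [Matrix.mul_assoc, Matrix.mul_one]
    _ = _ := by rw [xmat_neg_mul i i' hi, Matrix.mul_one]

lemma newC_pos (v : Equiv.Perm (Fin n)) (i i' : Fin n) (hi : (i : ℕ) + 1 = i') (hv : v i < v i')
    (B : Matrix (Fin n) (Fin n) ℝ) (hB : ∀ a b, b < a → B a b = 0) (hd : ∀ a, 0 < B a a)
    (hpos : ∀ S, 0 ≤ pl (pdot v * B) S) (p : ℝ) (hp : B i i' ≤ p * B i i) :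
    ∀ S, 0 ≤ pl (pdot v * newC i' p B) S := by
  have hne : i ≠ i' := by rw [ne_eq, Fin.ext_iff]; omega
  have K := keyData_of v B hB hd hpos i i' hi hv
  have e : pdot v * newC i' p B = newC i' p (pdot v * B) := by
    unfold newC; simp only [Matrix.mul_assoc]
  rw [e]
  refine pl_colstep (pdot v * B) _ i i' K.lt K.gap p ?_ ?_ ?_ hpos ?_
  · intro a; rw [newC_apply i i' hi, if_pos rfl]
  · intro a; rw [newC_apply i i' hi, if_neg hne.symm, if_pos rfl]
  · intro a x h1 h2; rw [newC_apply i i' hi, if_neg h1, if_neg h2]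
  · intro S h1 h2
    have h3 := K.claim S h1 h2
    have h4 := mul_le_mul_of_nonneg_right hp (hpos (insert i S))
    refine le_of_mul_le_mul_left (a := B i i) ?_ (hd i)
    linarith

lemma Inv.stepX {v wp : Equiv.Perm (Fin n)} {G W : Matrix (Fin n) (Fin n) ℝ} (H : Inv v wp G W)
    (i i' : Fin n) (hi : (i : ℕ) + 1 = i') (hv : v i < v i') (hw : wp i < wp i') (t : ℝ) (ht : 0 < t) :
    Inv v (wp * Equiv.swap i i') (G * xmat (i' : ℕ) t) (W * sdot (i' : ℕ)) := by
  have hne : i ≠ i' := by rw [ne_eq, Fin.ext_iff]; omega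
  have hlt : i < i' := by rw [Fin.lt_def]; omega
  obtain ⟨hG, hW, B, L, hB, hBd, hLd, hL, hGW, hpos⟩ := H
  have hS := congrArg Matrix.det (sdot_mul_T i i' hi)
  rw [Matrix.det_mul, Matrix.det_transpose, Matrix.det_one] at hS
  have hα := hBd i
  have hδ := hBd i'
  set p : ℝ := B i i' / B i i + B i' i' / (B i i * t) with hp
  have hpα : p * B i i = B i i' + B i' i' / t := by rw [hp]; field_simp
  have hpt : t * (p * B i i - B i i') = B i' i' := by rw [hpα]; field_simp; ring
  have hCL := stepL wp i i' hi hw L p hLd hL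
  refine ⟨?_, ?_, (xmat (i' : ℕ) t)ᵀ * newC i' p B, newL i' p L, ?_, ?_, hCL.1, hCL.2, ?_, ?_⟩
  · rw [Matrix.det_mul, det_xmat i i' hi, mul_one, hG]
  · rw [Matrix.det_mul, mul_pow, hW, one_mul, pow_two, hS]
  · intro a b hab
    rw [xmatT_mul _ i i' hi, newC_apply i i' hi, newC_apply i i' hi]
    by_cases ha : a = i'
    · subst ha
      by_cases hb : b = i
      · subst hb
        simp only [if_true]
        rw [hB a b hab, hpt]; ring
      · have hb' : b < i := by
          rw [Fin.ext_iff] at hb; rw [Fin.lt_def] at *; omega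
        simp [hb, hab.ne, hB a b hab, hB i b hb']
    · simp only [ha, if_false, add_zero]
      by_cases hb : b = i
      · subst hb
        have : i' < a := by
          rw [Fin.ext_iff] at ha; rw [Fin.lt_def] at *; omega
        simp [hB a b hab, hB a i' this]
      · by_cases hb' : b = i'
        · subst hb'
          simp [hb, hB a i (hlt.trans hab)]
        · simp [hb, hb', hB a b hab]
  · intro a
    rw [xmatT_mul _ i i' hi, newC_apply i i' hi, newC_apply i i' hi]
    by_cases ha : a = i'
    · subst ha
      simp only [hne.symm, if_false, if_true, hB a i hlt, zero_add]
      positivity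
    · simp only [ha, if_false, add_zero]
      by_cases hb : a = i
      · subst hb
        simp only [if_true]
        rw [hpα]
        have : 0 < B i' i' / t := by positivity
        linarith
      · simp [hb, hBd]
  · rw [Matrix.transpose_mul, Matrix.mul_assoc, ← Matrix.mul_assoc Gᵀ, hGW, Matrix.mul_assoc (xmat _ _)ᵀ,
      newC_newL i i' hi]
  · intro S
    rw [pdot_lower v i i' hi hv]
    refine newC_pos v i i' hi hv B hB hBd hpos p ?_ S
    rw [hpα]
    have : 0 < B i' i' / t := by positivity
    linarith

lemma Inv.stepS {v wp : Equiv.Perm (Fin n)} {G W : Matrix (Fin n) (Fin n) ℝ} (H : Inv v wp G W)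
    (i i' : Fin n) (hi : (i : ℕ) + 1 = i') (hv : v i < v i') (hw : wp i < wp i') :
    Inv (v * Equiv.swap i i') (wp * Equiv.swap i i') (G * sdot (i' : ℕ)) (W * sdot (i' : ℕ)) := by
  have hne : i ≠ i' := by rw [ne_eq, Fin.ext_iff]; omega
  have hlt : i < i' := by rw [Fin.lt_def]; omega
  obtain ⟨hG, hW, B, L, hB, hBd, hLd, hL, hGW, hpos⟩ := H
  have hS := congrArg Matrix.det (sdot_mul_T i i' hi)
  rw [Matrix.det_mul, Matrix.det_transpose, Matrix.det_one] at hS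
  have hα := hBd i
  have hδ := hBd i'
  set p : ℝ := B i i' / B i i with hp
  have hpα : p * B i i = B i i' := by rw [hp]; field_simp
  have hCL := stepL wp i i' hi hw L p hLd hL
  refine ⟨?_, ?_, (sdot (i' : ℕ))ᵀ * newC i' p B, newL i' p L, ?_, ?_, hCL.1, hCL.2, ?_, ?_⟩
  · rw [Matrix.det_mul, mul_pow, hG, one_mul, pow_two, hS]
  · rw [Matrix.det_mul, mul_pow, hW, one_mul, pow_two, hS]
  · intro a b hab
    rw [sdotT_mul _ i i' hi]
    simp only [newC_apply i i' hi]
    by_cases ha : a = i'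
    · subst ha
      simp only [hne.symm, if_false, if_true]
      by_cases hb : b = i
      · subst hb
        simp [hpα]
      · have hb' : b < i := by
          rw [Fin.ext_iff] at hb; rw [Fin.lt_def] at *; omega
        simp [hb, hab.ne, hB i b hb']
    · by_cases ha' : a = i
      · subst ha'
        simp [hab.ne, (hab.trans hlt).ne, hB i' b (hab.trans hlt)]
      simp only [ha, ha', if_false]
      by_cases hb : b = i
      · subst hb
        have : i' < a := by
          rw [Fin.ext_iff] at ha; rw [Fin.lt_def] at *; omega
        simp [hB a b hab, hB a i' this]
      · by_cases hb' : b = i'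
        · subst hb'
          simp [hb, hB a i (hlt.trans hab)]
        · simp [hb, hb', hB a b hab]
  · intro a
    rw [sdotT_mul _ i i' hi]
    simp only [newC_apply i i' hi]
    by_cases ha : a = i'
    · subst ha
      simp only [hne.symm, if_false, if_true]
      exact hα
    · by_cases hb : a = i
      · subst hb
        simp only [if_true]
        rw [hB i' a hlt]
        linarith
      · simp [ha, hb, hBd]
  · rw [Matrix.transpose_mul, Matrix.mul_assoc, ← Matrix.mul_assoc Gᵀ, hGW, Matrix.mul_assoc (sdot _)ᵀ,
      newC_newL i i' hi]
  · intro S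
    rw [← Matrix.mul_assoc, pdot_swap v i i' hi hv]
    exact newC_pos v i i' hi hv B hB hBd hpos p hpα.ge S

lemma Inv.base : Inv (1 : Equiv.Perm (Fin n)) 1 1 1 := by
  refine ⟨by simp, by simp, 1, 1, ?_, ?_, ?_, ?_, by simp, ?_⟩
  · intro a b h; exact Matrix.one_apply_ne h.ne'
  · intro a; simp
  · intro a; simp
  · intro a b h h'; exact absurd (Matrix.one_apply_ne h) h'
  · intro S
    have : (pdot 1 : Matrix (Fin n) (Fin n) ℝ) = 1 := by
      ext a b
      rw [pdot_apply, Matrix.one_apply]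
      have : sg (1 : Equiv.Perm (Fin n)) b = 1 := by
        unfold sg
        rw [Finset.filter_false_of_mem, Finset.card_empty, pow_zero]
        rintro k _ ⟨h1, h2⟩
        exact lt_asymm h1 h2
      simp [this]
    rw [this, mul_one]
    exact pl_one S

lemma len_swap (u : Equiv.Perm (Fin n)) (i i' : Fin n) (hi : (i : ℕ) + 1 = i') (hu : u i < u i') :
    len (u * Equiv.swap i i') = len u + 1 := by
  have hlt : i < i' := by rw [Fin.lt_def]; omega
  unfold len
  set s := Equiv.swap i i' with hs
  have hss : ∀ x, s (s x) = x := by intro x; simp [hs]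
  conv_rhs => rw [← Finset.card_map (f := (Equiv.prodCongr s s).toEmbedding)]
  rw [← Finset.card_insert_of_notMem (a := (i, i'))]
  · congr 1
    ext ⟨a, b⟩
    rw [Finset.mem_filter, Finset.mem_insert, Finset.mem_map_equiv, Finset.mem_filter]
    simp only [Finset.mem_univ, true_and,
      Equiv.prodCongr_symm, Equiv.prodCongr_apply, Prod.map_apply, Prod.mk.injEq, Equiv.Perm.mul_apply]
    have hsy : s.symm = s := by simp [hs]
    rw [hsy]
    constructor
    · rintro ⟨h1, h2⟩
      by_cases h : a = i ∧ b = i'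
      · exact Or.inl h
      · exact Or.inr ⟨swap_lt hi h1 h, h2⟩
    · rintro (⟨rfl, rfl⟩ | ⟨h1, h2⟩)
      · refine ⟨hlt, ?_⟩
        rw [hs, Equiv.swap_apply_left, Equiv.swap_apply_right]; exact hu
      · refine ⟨?_, h2⟩
        have h : ¬ (s a = i ∧ s b = i') := by
          rintro ⟨h3, h4⟩
          rw [h3, h4] at h2
          exact lt_asymm h2 hu
        have := swap_lt hi h1 h
        rw [← hs] at this
        rwa [hss, hss] at this
  · simp only [Finset.mem_map_equiv, Finset.mem_filter, Finset.mem_univ, true_and, Equiv.prodCongr_symm,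
      Equiv.prodCongr_apply, Prod.map_apply]
    have hsy : s.symm = s := by simp [hs]
    rw [hsy, hs, Equiv.swap_apply_left, Equiv.swap_apply_right]
    rintro ⟨h1, _⟩
    exact lt_asymm h1 hlt

lemma len_swap' (u : Equiv.Perm (Fin n)) (i i' : Fin n) (hi : (i : ℕ) + 1 = i') (hu : ¬ u i < u i') :
    len u = len (u * Equiv.swap i i') + 1 := by
  have hne : i ≠ i' := by rw [ne_eq, Fin.ext_iff]; omega
  have h := len_swap (u * Equiv.swap i i') i i' hi (by
    simp only [Equiv.Perm.mul_apply, Equiv.swap_apply_left, Equiv.swap_apply_right]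
    exact lt_of_le_of_ne (not_lt.1 hu) (fun h => hne (u.injective h.symm)))
  rw [mul_assoc, Equiv.swap_mul_self, mul_one] at h
  exact h

lemma len_one : len (1 : Equiv.Perm (Fin n)) = 0 := by
  unfold len
  rw [Finset.card_eq_zero, Finset.filter_false_of_mem]
  rintro ⟨a, b⟩ _ ⟨h1, h2⟩
  exact lt_asymm h1 h2

lemma tight (f : ℕ → ℕ) (m : ℕ) (h0 : f 0 = 0) (hs : ∀ r, r < m → f (r+1) ≤ f r + 1) (hm : f m = m) :
    ∀ r, r ≤ m → f r = r := by
  have h1 : ∀ r, r ≤ m → f r ≤ r := by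
    intro r
    induction r with
    | zero => intro _; omega
    | succ r ih => intro h; have := ih (by omega); have := hs r (by omega); omega
  have h2 : ∀ d, d ≤ m → m ≤ f (m - d) + d := by
    intro d
    induction d with
    | zero => intro _; simp [hm]
    | succ d ih =>
      intro h
      have h3 := ih (by omega)
      have h4 := hs (m - (d+1)) (by omega)
      rw [show m - (d+1) + 1 = m - d by omega] at h4
      omega
  intro r hr
  have h3 := h2 (m - r) (by omega)
  have h4 := h1 r hr
  rw [show m - (m - r) = r by omega] at h3
  omega

lemma sperm_eq {N : ℕ} (j : ℕ) (h : j < N) :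
    sperm N j = Equiv.swap ⟨j - 1, Nat.lt_of_le_of_lt (Nat.sub_le j 1) h⟩ ⟨j, h⟩ := by
  unfold sperm; rw [dif_pos h]

lemma main_inv {n m : ℕ} (ii : Fin m → ℕ)
    (hii : ∀ r, 1 ≤ ii r ∧ ii r < n)
    (hred : len (sPermList n ii).prod = m)
    (v : Equiv.Perm (Fin n)) (hv0 : vseq ii v m = 1)
    (t : Fin m → ℝ) (ht : ∀ r, inJ ii v r → 0 < t r) :
    ∀ r, r ≤ m → Inv (vseq ii v (m - r)) ((sPermList n ii).take r).prod ((mrgList ii v t).take r).prod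
      ((sdotList n ii).take r).prod := by
  have hlen1 : (sPermList n ii).length = m := by simp [sPermList]
  have hlen2 : (mrgList ii v t).length = m := by simp [mrgList]
  have hlen3 : (sdotList n ii : List (Matrix (Fin n) (Fin n) ℝ)).length = m := by simp [sdotList]
  have hP : ∀ r (hr : r < m), ((sPermList n ii).take (r+1)).prod =
      ((sPermList n ii).take r).prod * sperm n (ii ⟨r, hr⟩) := by
    intro r hr
    rw [List.prod_take_succ _ _ (by rw [hlen1]; exact hr)]
    simp [sPermList]
  have htight := tight (fun r => len ((sPermList n ii).take r).prod) m (by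
      simp only [List.take_zero, List.prod_nil, len_one]) (by
      intro r hr
      rw [hP r hr, sperm_eq _ (hii _).2]
      have h1 := (hii ⟨r, hr⟩).1
      have hi : ((⟨ii ⟨r, hr⟩ - 1, Nat.lt_of_le_of_lt (Nat.sub_le _ 1) (hii ⟨r, hr⟩).2⟩ : Fin n) : ℕ) + 1
          = ((⟨ii ⟨r, hr⟩, (hii ⟨r, hr⟩).2⟩ : Fin n) : ℕ) := by simp; omega
      by_cases h : ((sPermList n ii).take r).prod ⟨ii ⟨r, hr⟩ - 1, Nat.lt_of_le_of_lt (Nat.sub_le _ 1) (hii ⟨r, hr⟩).2⟩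
          < ((sPermList n ii).take r).prod ⟨ii ⟨r, hr⟩, (hii ⟨r, hr⟩).2⟩
      · rw [len_swap _ _ _ hi h]
      · have := len_swap' _ _ _ hi h
        omega) (by
      rw [List.take_of_length_le hlen1.le]; exact hred)
  intro r
  induction r with
  | zero =>
    intro _
    simp only [List.take_zero, List.prod_nil, Nat.sub_zero, hv0]
    exact Inv.base
  | succ r ih =>
    intro hr1
    have hr : r < m := hr1
    have IH := ih hr.le
    have h1 := (hii ⟨r, hr⟩).1
    obtain ⟨i', hi'⟩ : ∃ i' : Fin n, (i' : ℕ) = ii ⟨r, hr⟩ := ⟨⟨_, (hii ⟨r, hr⟩).2⟩, rfl⟩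
    obtain ⟨i, hi⟩ : ∃ i : Fin n, (i : ℕ) + 1 = i' := ⟨⟨i' - 1, by have := i'.2; omega⟩, by simp; omega⟩
    have hsp : sperm n (ii ⟨r, hr⟩) = Equiv.swap i i' := by
      rw [sperm_eq _ (hii _).2]
      congr 1
      · ext; simp; omega
      · ext; simp; omega
    have hPr := hP r hr
    rw [hsp] at hPr
    have hw : ((sPermList n ii).take r).prod i < ((sPermList n ii).take r).prod i' := by
      by_contra h
      have h2 := len_swap' _ _ _ hi h
      have h3 := htight (r+1) hr1
      have h4 := htight r hr.le
      rw [hPr] at h3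
      omega
    have hG : ((mrgList ii v t).take (r+1)).prod = ((mrgList ii v t).take r).prod *
        (if inJ ii v ⟨r, hr⟩ then xmat (i' : ℕ) (t ⟨r, hr⟩) else sdot (i' : ℕ)) := by
      rw [List.prod_take_succ _ _ (by rw [hlen2]; exact hr)]
      simp [mrgList, hi']
    have hW : ((sdotList n ii : List (Matrix (Fin n) (Fin n) ℝ)).take (r+1)).prod =
        ((sdotList n ii).take r).prod * sdot (i' : ℕ) := by
      rw [List.prod_take_succ _ _ (by rw [hlen3]; exact hr)]
      simp [sdotList, hi']
    obtain ⟨k, hk⟩ : ∃ k, m - r = k + 1 := ⟨m - r - 1, by omega⟩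
    have hk' : m - (r+1) = k := by omega
    have hkr : m - k - 1 = r := by omega
    have hJ : inJ ii v ⟨r, hr⟩ ↔ vseq ii v (k+1) = vseq ii v k := by
      unfold inJ
      simp only [hk, Nat.add_sub_cancel]
    have hrec : vseq ii v (k+1) = if len (vseq ii v k * Equiv.swap i i') < len (vseq ii v k)
        then vseq ii v k * Equiv.swap i i' else vseq ii v k := by
      have hlt : m - k - 1 < m := by omega
      have hfin : (⟨m - k - 1, hlt⟩ : Fin m) = ⟨r, hr⟩ := by ext; simp [hkr]
      rw [vseq, dif_pos hlt, hfin, hsp]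
    rw [hk] at IH
    rw [hk', hPr, hG, hW]
    have hne : i ≠ i' := by rw [ne_eq, Fin.ext_iff]; omega
    by_cases hc : vseq ii v k i < vseq ii v k i'
    · have h2 := len_swap _ _ _ hi hc
      rw [if_neg (by omega)] at hrec
      rw [if_pos (hJ.2 hrec)]
      rw [hrec] at IH
      exact IH.stepX i i' hi hc hw _ (ht _ (hJ.2 hrec))
    · have h2 := len_swap' _ _ _ hi hc
      rw [if_pos (by omega)] at hrec
      have hnJ : ¬ inJ ii v ⟨r, hr⟩ := by
        rw [hJ, hrec]
        intro h
        rw [h] at h2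
        omega
      rw [if_neg hnJ]
      have h3 : vseq ii v k = vseq ii v (k+1) * Equiv.swap i i' := by
        rw [hrec, mul_assoc, Equiv.swap_mul_self, mul_one]
      have h4 : vseq ii v (k+1) i < vseq ii v (k+1) i' := by
        rw [hrec]
        simp only [Equiv.Perm.mul_apply, Equiv.swap_apply_left, Equiv.swap_apply_right]
        exact lt_of_le_of_ne (not_lt.1 hc) (fun h => hne ((vseq ii v k).injective h.symm))
      rw [h3]
      exact IH.stepS i i' hi h4 hw

lemma up_mul {A B : Matrix (Fin n) (Fin n) ℝ} (hA : ∀ a b, b < a → A a b = 0) (hB : ∀ a b, b < a → B a b = 0) :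
    (∀ a b, b < a → (A * B) a b = 0) ∧ ∀ a, (A * B) a a = A a a * B a a := by
  constructor
  · intro a b hab
    rw [Matrix.mul_apply]
    refine Finset.sum_eq_zero fun c _ => ?_
    rcases lt_or_ge c a with h | h
    · rw [hA _ _ h, zero_mul]
    · rw [hB _ _ (hab.trans_le h), mul_zero]
  · intro a
    rw [Matrix.mul_apply, Finset.sum_eq_single a]
    · intro c _ hc
      rcases lt_or_gt_of_ne hc with h | h
      · rw [hA _ _ h, zero_mul]
      · rw [hB _ _ h, mul_zero]
    · simp

lemma up_inv {A : Matrix (Fin n) (Fin n) ℝ} (hd : ∀ a, A a a = 1) (hA : ∀ a b, b < a → A a b = 0) :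
    ∃ A' : Matrix (Fin n) (Fin n) ℝ, A' * A = 1 ∧ A * A' = 1 ∧ (∀ a b, b < a → A' a b = 0) := by
  have hdet : A.det = 1 := by
    rw [Matrix.det_of_isUpperTriangular]
    · simp [hd]
    · intro a b hab; exact hA _ _ hab
  have : Invertible A := A.invertibleOfIsUnitDet (by rw [hdet]; exact isUnit_one)
  refine ⟨A⁻¹, Matrix.inv_mul_of_invertible A, Matrix.mul_inv_of_invertible A, ?_⟩
  have hT : A.BlockTriangular id := fun a b hab => hA _ _ hab
  intro a b hab
  exact Matrix.blockTriangular_inv_of_blockTriangular hT hab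

end plucker

/-- the right pre-twist of a totally positive Marsh–Rietsch element is
totally nonnegative (type A). -/
theorem statement_10 {n m : ℕ} (hn : 1 ≤ n) (ii : Fin m → ℕ)
    (hii : ∀ r, 1 ≤ ii r ∧ ii r < n)
    (w : Equiv.Perm (Fin n)) (hw : w = (sPermList n ii).prod) (hred : len w = m)
    (v : Equiv.Perm (Fin n)) (hv0 : vseq ii v m = 1)
    (t : Fin m → ℝ) (ht : ∀ r, inJ ii v r → 0 < t r) :
    (∃ a b c, UDL ((mrg ii v t)ᵀ * wMR n ii) a b c) ∧
    ∀ a b c, UDL ((mrg ii v t)ᵀ * wMR n ii) a b c →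
      TopFlagNonneg (pdot v * a) := by
  rw [hw] at hred
  have H := main_inv ii hii hred v hv0 t ht m le_rfl
  rw [Nat.sub_self, List.take_of_length_le (by simp [sPermList]), List.take_of_length_le (by simp [mrgList]),
    List.take_of_length_le (by simp [sdotList])] at H
  change Inv v _ (mrg ii v t) (wMR n ii) at H
  obtain ⟨hG, hW, B, L, hB, hBd, hLd, hL, hGW, hpos⟩ := H
  have hLz : ∀ a b : Fin n, a < b → L a b = 0 := by
    intro a b hab
    by_contra h
    exact lt_asymm hab (hL a b hab.ne h).1
  have hLdet : L.det = 1 := by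
    rw [Matrix.det_of_isLowerTriangular]
    · simp [hLd]
    · intro a b hab; exact hLz _ _ (by simpa using hab)
  have hBdet : B.det = ∏ a, B a a := by
    rw [Matrix.det_of_isUpperTriangular]
    intro a b hab; exact hB _ _ hab
  have hB1 : B.det = 1 := by
    have h1 : 0 < B.det := by rw [hBdet]; exact Finset.prod_pos fun a _ => hBd a
    have h2 := congrArg Matrix.det hGW
    rw [Matrix.det_mul, Matrix.det_mul, Matrix.det_transpose, hLdet, mul_one] at h2
    have h3 : B.det ^ 2 = 1 := by rw [← h2, mul_pow, hG, hW, one_mul]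
    nlinarith
  constructor
  · refine ⟨B * Matrix.diagonal (fun a => (B a a)⁻¹), Matrix.diagonal (fun a => B a a), L, ?_, ?_, ⟨hLd, hLz⟩, ?_⟩
    · constructor
      · intro a
        rw [Matrix.mul_diagonal]
        exact mul_inv_cancel₀ (hBd a).ne'
      · intro a b hab
        rw [Matrix.mul_diagonal, hB a b hab, zero_mul]
    · constructor
      · rw [Matrix.det_diagonal, ← hBdet, hB1]
      · intro a b hab
        exact Matrix.diagonal_apply_ne _ hab
    · rw [hGW, Matrix.mul_assoc B, Matrix.diagonal_mul_diagonal]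
      have : (fun a => (B a a)⁻¹ * B a a) = fun _ => (1 : ℝ) := by
        funext a; exact inv_mul_cancel₀ (hBd a).ne'
      rw [this, Matrix.diagonal_one, Matrix.mul_one]
  · rintro a b c ⟨⟨had, haz⟩, ⟨_, hbz⟩, ⟨hcd, hcz⟩, habc⟩
    obtain ⟨a', ha1, ha2, ha3⟩ := up_inv had haz
    obtain ⟨l', hl1, hl2, hl3⟩ := up_inv (A := Lᵀ) (fun x => by simp [hLd]) (fun x y h => by simp [hLz y x h])
    have hl4 : L * l'ᵀ = 1 := by
      have := congrArg Matrix.transpose hl1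
      rwa [Matrix.transpose_mul, Matrix.transpose_transpose, Matrix.transpose_one] at this
    have hBe : B = a * (b * c * l'ᵀ) := by
      calc B = B * L * l'ᵀ := by rw [Matrix.mul_assoc, hl4, Matrix.mul_one]
        _ = _ := by rw [← hGW, habc]; simp only [Matrix.mul_assoc]
    set D := b * c * l'ᵀ with hD
    have hDe : D = a' * B := by rw [hBe, ← Matrix.mul_assoc, ha1, Matrix.one_mul]
    have hDup : ∀ x y, y < x → D x y = 0 := by
      rw [hDe]; exact (up_mul ha3 hB).1
    have hDT : Dᵀ = l' * (cᵀ * bᵀ) := by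
      rw [hD, Matrix.transpose_mul, Matrix.transpose_mul, Matrix.transpose_transpose]
    have hDlow : ∀ x y, x < y → D x y = 0 := by
      intro x y hxy
      have h1 : ∀ p q : Fin n, q < p → cᵀ p q = 0 := fun p q h => hcz q p h
      have h2 : ∀ p q : Fin n, q < p → bᵀ p q = 0 := fun p q h => hbz q p h.ne
      have := (up_mul hl3 (up_mul h1 h2).1).1 y x hxy
      rwa [← hDT] at this
    have hBD : ∀ x j, B x j = a x j * D j j := by
      intro x j
      conv_lhs => rw [hBe]
      rw [Matrix.mul_apply, Finset.sum_eq_single j]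
      · intro k _ hk
        rcases lt_or_gt_of_ne hk with h | h
        · rw [hDlow _ _ h, mul_zero]
        · rw [hDup _ _ h, mul_zero]
      · simp
    have hDpos : ∀ j, 0 < D j j := by
      intro j
      have := hBd j
      rwa [hBD, had, one_mul] at this
    intro J
    rw [minor_eq_pl]
    obtain ⟨f, hf⟩ := pl_diag (pdot v * a) (pdot v * B) (fun j => D j j) (by
      intro x j
      rw [Matrix.mul_apply, Matrix.mul_apply, Finset.sum_mul]
      refine Finset.sum_congr rfl fun k _ => ?_
      rw [hBD k j]; ring) J
    have h1 := hpos J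
    rw [hf] at h1
    exact nonneg_of_mul_nonneg_right h1 (Finset.prod_pos fun b _ => hDpos _)

end
end Paper
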